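/- For every integer m ≥ 1 and every γ > 0 there exists an integer n₀ such that for every n ≥ n₀ divisible by 3m, every 3-graph H on n vertices with minimum vertex degree δ₁(H) ≥ (5/9 + γ)·C(n,2) contains a K₃³(m)-factor. -/

import Mathlib

open Finset

/-- `A` is the vertex set of a copy of the hypergraph with vertex type `V` and edge set `EF`
inside the hypergraph on `Fin n` with edge set `E`. -/
def IsCopy {n : ℕ} {V : Type} [Fintype V] [DecidableEq V] (E : Finset (Finset (Fin n)))
    (EF : Finset (Finset V)) (A : Finset (Fin n)) : Prop :=
  ∃ f : V ↪ Fin n, Finset.map f Finset.univ = A ∧ ∀ e ∈ EF, e.map f ∈ E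

/-- The induced subhypergraph of `E` on `S` has an `F`-factor, where `F` has vertex type `V`
and edge set `EF`: there are pairwise vertex-disjoint copies of `F` covering exactly `S`. -/
def HasFactorOn {n : ℕ} {V : Type} [Fintype V] [DecidableEq V] (E : Finset (Finset (Fin n)))
    (EF : Finset (Finset V)) (S : Finset (Fin n)) : Prop :=
  ∃ P : Finset (Finset (Fin n)), (∀ A ∈ P, IsCopy E EF A) ∧
    (P : Set (Finset (Fin n))).PairwiseDisjoint id ∧ P.biUnion id = S

/-- `x` is `(F, i, η)`-close to `y`. -/
def CloseTo {n : ℕ} {V : Type} [Fintype V] [DecidableEq V] (E : Finset (Finset (Fin n)))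
    (EF : Finset (Finset V)) (i : ℕ) (η : ℝ) (x y : Fin n) : Prop :=
  η * (n : ℝ) ^ (i * Fintype.card V - 1) ≤
    (({S : Finset (Fin n) | S.card = i * Fintype.card V - 1 ∧ x ∉ S ∧ y ∉ S ∧
      HasFactorOn E EF (insert x S) ∧ HasFactorOn E EF (insert y S)}).ncard : ℝ)

/-- `H` is `(F, i, η)`-closed. -/
def IsClosedGraph {n : ℕ} {V : Type} [Fintype V] [DecidableEq V] (E : Finset (Finset (Fin n)))
    (EF : Finset (Finset V)) (i : ℕ) (η : ℝ) : Prop :=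
  ∀ x y : Fin n, x ≠ y → CloseTo E EF i η x y

/-- `Ñ_{F,i,η}(x)`: the set of vertices `(F, i, η)`-close to `x`. -/
def Ntilde {n : ℕ} {V : Type} [Fintype V] [DecidableEq V] (E : Finset (Finset (Fin n)))
    (EF : Finset (Finset V)) (i : ℕ) (η : ℝ) (x : Fin n) : Set (Fin n) :=
  {y | CloseTo E EF i η x y}

/-- Degree of the set `T` in the `k`-graph with edge set `E`. -/
noncomputable def degOn {n : ℕ} (E : Finset (Finset (Fin n))) (k : ℕ) (T : Finset (Fin n)) : ℕ :=
  ({S : Finset (Fin n) | S.card = k - T.card ∧ Disjoint S T ∧ S ∪ T ∈ E}).ncard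

/-- Edge set of the complete `k`-graph `K_t^k` on `Fin t`. -/
def cliqueEdges (t k : ℕ) : Finset (Finset (Fin t)) :=
  Finset.powersetCard k (Finset.univ : Finset (Fin t))

/-- Edge set of the complete `k`-partite `k`-graph `K_k^k(m)` with parts of size `m`. -/
def multipartiteEdges (k m : ℕ) : Finset (Finset (Fin k × Fin m)) :=
  Finset.univ.filter (fun e : Finset (Fin k × Fin m) =>
    ∀ i : Fin k, (e.filter (fun v => v.1 = i)).card = 1)


/-- The number of elements of a finite type satisfying a predicate. -/
noncomputable def num {α : Type*} [Fintype α] (p : α → Prop) : ℕ :=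
  open Classical in (Finset.univ.filter p).card

section Counting

variable {α β ι : Type*} [Fintype α] [Fintype β] [Fintype ι]

lemma num_le_card (p : α → Prop) : num p ≤ Fintype.card α := by
  classical
  exact Finset.card_le_univ _

lemma num_mono {p q : α → Prop} (h : ∀ a, p a → q a) : num p ≤ num q := by
  classical
  exact Finset.card_le_card (Finset.monotone_filter_right _ (fun a _ => h a))

lemma num_le_of_injective {p : α → Prop} {q : β → Prop} (f : α → β) (hf : Function.Injective f)
    (h : ∀ a, p a → q (f a)) : num p ≤ num q := by
  classical
  refine Finset.card_le_card_of_injOn f ?_ hf.injOn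
  intro a ha
  simpa using h a (by simpa using ha)

lemma num_le_of_injOn {p : α → Prop} {q : β → Prop} (f : α → β)
    (hf : ∀ a a', p a → p a' → f a = f a' → a = a')
    (h : ∀ a, p a → q (f a)) : num p ≤ num q := by
  classical
  refine Finset.card_le_card_of_injOn f ?_ ?_
  · intro a ha
    simpa using h a (by simpa using ha)
  · intro a ha a' ha' hh
    exact hf a a' (by simpa using ha) (by simpa using ha') hh

lemma num_equiv (e : α ≃ β) (q : β → Prop) : num (fun a => q (e a)) = num q := by
  apply le_antisymm
  · exact num_le_of_injective e e.injective (fun a h => h)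
  · exact num_le_of_injective e.symm e.symm.injective (fun a h => by simpa using h)

lemma num_eq_sum (p : α → Prop) : num p = ∑ a, (open Classical in if p a then 1 else 0) := by
  classical
  unfold num
  rw [Finset.card_filter]

lemma num_prod (P : α → β → Prop) :
    num (fun p : α × β => P p.1 p.2) = ∑ a, num (P a) := by
  simp_rw [num_eq_sum]
  rw [Fintype.sum_prod_type]

lemma num_prod_right (P : α → β → Prop) :
    num (fun p : α × β => P p.1 p.2) = ∑ b, num (fun a => P a b) := by
  simp_rw [num_eq_sum]
  rw [Fintype.sum_prod_type_right]

lemma num_and (p : α → Prop) (q : β → Prop) :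
    num (fun x : α × β => p x.1 ∧ q x.2) = num p * num q := by
  classical
  rw [num_prod (fun a b => p a ∧ q b)]
  have : ∀ a, num (fun b => p a ∧ q b) = (if p a then 1 else 0) * num q := by
    intro a
    by_cases h : p a <;> simp [h, num]
  rw [Finset.sum_congr rfl (fun a _ => this a), ← Finset.sum_mul, ← num_eq_sum]

lemma num_pi [DecidableEq ι] (p : ι → α → Prop) :
    num (fun f : ι → α => ∀ i, p i (f i)) = ∏ i, num (p i) := by
  classical
  unfold num
  rw [← Fintype.card_piFinset]
  congr 1
  ext f
  simp [Fintype.mem_piFinset]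

lemma num_or_le (p q : α → Prop) : num (fun a => p a ∨ q a) ≤ num p + num q := by
  classical
  unfold num
  refine le_trans (Finset.card_le_card ?_) (Finset.card_union_le _ _)
  intro a ha
  simpa using ha

lemma num_exists_le (p : ι → α → Prop) : num (fun a => ∃ i, p i a) ≤ ∑ i, num (p i) := by
  classical
  unfold num
  refine le_trans (Finset.card_le_card ?_) (Finset.card_biUnion_le)
  intro a ha
  simpa using ha

lemma num_add_num_not (p : α → Prop) : num p + num (fun a => ¬ p a) = Fintype.card α := by
  classical
  have := Finset.card_filter_add_card_filter_not (s := (Finset.univ : Finset α)) p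
  unfold num
  rw [← Finset.card_univ]
  convert this

lemma num_add_num_le (p q : α → Prop) :
    num p + num q ≤ num (fun a => p a ∧ q a) + Fintype.card α := by
  have h1 := num_or_le (fun a => p a ∧ q a) (fun a => ¬ q a)
  have h2 : num p ≤ num (fun a => (p a ∧ q a) ∨ ¬ q a) := num_mono (by tauto)
  have h3 := num_add_num_not q
  omega

/-- Markov's inequality. -/
lemma mul_num_le_sum (f : α → ℝ) (hf : ∀ a, 0 ≤ f a) (c : ℝ) :
    c * num (fun a => c ≤ f a) ≤ ∑ a, f a := by
  classical
  unfold num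
  calc c * ((Finset.univ.filter (fun a => c ≤ f a)).card : ℝ)
      = ∑ a ∈ Finset.univ.filter (fun a => c ≤ f a), c := by
        rw [Finset.sum_const, nsmul_eq_mul, mul_comm]
    _ ≤ ∑ a ∈ Finset.univ.filter (fun a => c ≤ f a), f a :=
        Finset.sum_le_sum (fun a ha => by simpa using ha)
    _ ≤ ∑ a, f a := Finset.sum_le_sum_of_subset_of_nonneg (Finset.subset_univ _)
        (fun a _ _ => hf a)

/-- A large average forces many large values. -/
lemma sum_le_num_mul_add (f : α → ℝ) (M c : ℝ) (hM : ∀ a, f a ≤ M) (hc : 0 ≤ c) :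
    ∑ a, f a ≤ num (fun a => c ≤ f a) * M + c * Fintype.card α := by
  classical
  have h1 : ∑ a, f a ≤ ∑ a, ((if c ≤ f a then M else 0) + c) := by
    refine Finset.sum_le_sum (fun a _ => ?_)
    split_ifs with h
    · linarith [hM a]
    · linarith
  refine h1.trans (le_of_eq ?_)
  rw [Finset.sum_add_distrib, ← Finset.sum_filter, Finset.sum_const, Finset.sum_const]
  simp only [nsmul_eq_mul, Finset.card_univ]
  unfold num
  rw [mul_comm c]

lemma exists_of_lt_num {p q : α → Prop} (h : num q < num p) : ∃ a, p a ∧ ¬ q a := by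
  by_contra! hc
  exact absurd (num_mono hc) (not_le.mpr h)

lemma num_apply_eq [DecidableEq ι] {a b : ι} (hab : a ≠ b) :
    num (fun f : ι → α => f a = f b) * Fintype.card α = Fintype.card α ^ Fintype.card ι := by
  rw [← Fintype.card_fun (α := ι) (β := α)]
  have h1 : Fintype.card (ι → α) = num (fun _ : ι → α => True) := by simp [num]
  have h2 : num (fun f : ι → α => f a = f b) * Fintype.card α =
      num (fun x : (ι → α) × α => x.1 a = x.1 b ∧ True) := by
    rw [num_and (fun f : ι → α => f a = f b) (fun _ : α => True)]
    simp [num]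
  rw [h1, h2]
  apply le_antisymm
  · refine num_le_of_injOn (fun x => Function.update x.1 b x.2) ?_ (fun _ _ => trivial)
    rintro ⟨f, v⟩ ⟨g, w⟩ hf hg h
    simp only [and_true] at hf hg h
    have hv : v = w := by simpa using congrFun h b
    have hne : ∀ i, i ≠ b → f i = g i := by
      intro i hi
      simpa [Function.update_of_ne hi] using congrFun h i
    have : f = g := by
      funext i
      by_cases hi : i = b
      · subst hi
        rw [← hf, ← hg, hne a hab]
      · exact hne i hi
    rw [this, hv]
  · refine num_le_of_injOn (fun f => (Function.update f b (f a), f b)) ?_ ?_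
    · intro f g _ _ h
      simp only [Prod.mk.injEq] at h
      funext i
      by_cases hi : i = b
      · rw [hi, h.2]
      · simpa [Function.update_of_ne hi] using congrFun h.1 i
    · intro f _
      simp [Function.update_of_ne hab]

lemma num_apply_eq_const [DecidableEq ι] (a : ι) (v : α) :
    num (fun f : ι → α => f a = v) * Fintype.card α = Fintype.card α ^ Fintype.card ι := by
  rw [← Fintype.card_fun (α := ι) (β := α)]
  have h1 : Fintype.card (ι → α) = num (fun _ : ι → α => True) := by simp [num]
  have h2 : num (fun f : ι → α => f a = v) * Fintype.card α =
      num (fun x : (ι → α) × α => x.1 a = v ∧ True) := by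
    rw [num_and (fun f : ι → α => f a = v) (fun _ : α => True)]
    simp [num]
  rw [h1, h2]
  apply le_antisymm
  · refine num_le_of_injOn (fun x => Function.update x.1 a x.2) ?_ (fun _ _ => trivial)
    rintro ⟨f, v'⟩ ⟨g, w⟩ hf hg h
    simp only [and_true] at hf hg h
    have hv : v' = w := by simpa using congrFun h a
    have : f = g := by
      funext i
      by_cases hi : i = a
      · subst hi
        rw [hf, hg]
      · simpa [Function.update_of_ne hi] using congrFun h i
    rw [this, hv]
  · refine num_le_of_injOn (fun f => (Function.update f a v, f a)) ?_ ?_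
    · intro f g _ _ h
      simp only [Prod.mk.injEq] at h
      funext i
      by_cases hi : i = a
      · rw [hi, h.2]
      · simpa [Function.update_of_ne hi] using congrFun h.1 i
    · intro f _
      simp

/-- Almost all functions are injective. -/
lemma num_not_injective_mul_le [DecidableEq ι] :
    num (fun f : ι → α => ¬ Function.Injective f) * Fintype.card α ≤
      Fintype.card ι ^ 2 * Fintype.card α ^ Fintype.card ι := by
  have h1 : num (fun f : ι → α => ¬ Function.Injective f) ≤
      ∑ q : ι × ι, num (fun f : ι → α => q.1 ≠ q.2 ∧ f q.1 = f q.2) := by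
    refine le_trans (num_mono ?_) (num_exists_le _)
    intro f hf
    simp only [Function.Injective] at hf
    push Not at hf
    obtain ⟨a, b, h, hab⟩ := hf
    exact ⟨(a, b), hab, h⟩
  calc _ ≤ (∑ q : ι × ι, num (fun f : ι → α => q.1 ≠ q.2 ∧ f q.1 = f q.2)) * Fintype.card α :=
        Nat.mul_le_mul_right _ h1
    _ = ∑ q : ι × ι, num (fun f : ι → α => q.1 ≠ q.2 ∧ f q.1 = f q.2) * Fintype.card α := by
        rw [Finset.sum_mul]
    _ ≤ ∑ q : ι × ι, Fintype.card α ^ Fintype.card ι := by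
        refine Finset.sum_le_sum (fun q _ => ?_)
        by_cases hq : q.1 = q.2
        · simp [hq, num]
        · rw [← num_apply_eq (α := α) hq]
          exact Nat.mul_le_mul_right _ (num_mono (fun f h => h.2))
    _ = _ := by
        simp [sq]

/-- Almost all functions have a range that avoids a small set. -/
lemma num_exists_apply_eq_mul_le [DecidableEq ι] (u : β → α) :
    num (fun f : ι → α => ∃ i b, f i = u b) * Fintype.card α ≤
      Fintype.card ι * Fintype.card β * Fintype.card α ^ Fintype.card ι := by
  have h1 : num (fun f : ι → α => ∃ i b, f i = u b) ≤
      ∑ q : ι × β, num (fun f : ι → α => f q.1 = u q.2) := by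
    refine le_trans (num_mono ?_) (num_exists_le _)
    rintro f ⟨i, b, h⟩
    exact ⟨(i, b), h⟩
  calc _ ≤ (∑ q : ι × β, num (fun f : ι → α => f q.1 = u q.2)) * Fintype.card α :=
        Nat.mul_le_mul_right _ h1
    _ = ∑ q : ι × β, Fintype.card α ^ Fintype.card ι := by
        rw [Finset.sum_mul]
        exact Finset.sum_congr rfl (fun q _ => num_apply_eq_const _ _)
    _ = _ := by
        simp

/-- Blowing up one side of a bipartite relation. -/
lemma blowup_one (r : α → β → Prop) (m : ℕ) (d : ℝ) (hd : 0 ≤ d)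
    (h : d * (Fintype.card α * Fintype.card β) ≤ num (fun p : α × β => r p.1 p.2)) :
    d ^ m * (Fintype.card α ^ m * Fintype.card β) ≤
      num (fun p : (Fin m → α) × β => ∀ i, r (p.1 i) p.2) := by
  have h1 : num (fun p : (Fin m → α) × β => ∀ i, r (p.1 i) p.2) =
      ∑ b, num (fun a => r a b) ^ m := by
    rw [num_prod_right (fun (f : Fin m → α) b => ∀ i, r (f i) b)]
    refine Finset.sum_congr rfl (fun b _ => ?_)
    rw [num_pi (fun _ a => r a b)]
    simp
  rw [h1]
  rw [num_prod_right] at h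
  push_cast at h ⊢
  cases m with
  | zero => simp
  | succ k =>
    rcases Nat.eq_zero_or_pos (Fintype.card β) with hb | hb
    · rw [hb]
      simp only [Nat.cast_zero, mul_zero]
      positivity
    have hb' : (0 : ℝ) < Fintype.card β := by exact_mod_cast hb
    have h2 := pow_sum_div_card_le_sum_pow (s := (Finset.univ : Finset β))
      (f := fun b => (num (fun a => r a b) : ℝ)) (fun _ _ => by positivity) k
    refine le_trans ?_ h2
    rw [Finset.card_univ, le_div_iff₀ (by positivity)]
    calc d ^ (k + 1) * (Fintype.card α ^ (k + 1) * Fintype.card β) * (Fintype.card β : ℝ) ^ k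
        = (d * (Fintype.card α * Fintype.card β)) ^ (k + 1) := by ring
      _ ≤ _ := pow_le_pow_left₀ (by positivity) h _

/-- Blowing up a dense tripartite relation. -/
lemma blowup_three {γ : Type*} [Fintype γ] (T : α → β → γ → Prop) (m : ℕ) (d : ℝ) (hd : 0 ≤ d)
    (h : d * (Fintype.card α * Fintype.card β * Fintype.card γ) ≤
      num (fun p : α × β × γ => T p.1 p.2.1 p.2.2)) :
    d ^ (m ^ 3) * (Fintype.card α ^ m * Fintype.card β ^ m * Fintype.card γ ^ m) ≤
      num (fun p : (Fin m → α) × (Fin m → β) × (Fin m → γ) =>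
        ∀ i j k, T (p.1 i) (p.2.1 j) (p.2.2 k)) := by
  have h1 := blowup_one (fun a (q : β × γ) => T a q.1 q.2) m d hd (by
    rw [Fintype.card_prod]; push_cast; linarith)
  have h2 := blowup_one (fun b (q : (Fin m → α) × γ) => ∀ i, T (q.1 i) b q.2) m (d ^ m)
    (by positivity) (by
      refine le_trans (le_of_eq ?_) (h1.trans ?_)
      · simp only [Fintype.card_prod, Fintype.card_fun, Fintype.card_fin]; push_cast; ring
      · refine Nat.cast_le.mpr (num_le_of_injective
          (fun p : (Fin m → α) × β × γ => (p.2.1, p.1, p.2.2)) (by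
            rintro ⟨a, b, c⟩ ⟨a', b', c'⟩ h; simp_all) (fun p hp => ?_))
        exact hp)
  have h3 := blowup_one (fun c (q : (Fin m → α) × (Fin m → β)) => ∀ j i, T (q.1 i) (q.2 j) c) m
    ((d ^ m) ^ m) (by positivity) (by
      refine le_trans (le_of_eq ?_) (h2.trans ?_)
      · simp only [Fintype.card_prod, Fintype.card_fun, Fintype.card_fin]; push_cast; ring
      · refine Nat.cast_le.mpr (num_le_of_injective
          (fun p : (Fin m → β) × (Fin m → α) × γ => (p.2.2, p.2.1, p.1)) (by
            rintro ⟨a, b, c⟩ ⟨a', b', c'⟩ h; simp_all) (fun p hp => ?_))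
        exact hp)
  refine le_trans (le_of_eq ?_) (h3.trans ?_)
  · simp only [Fintype.card_prod, Fintype.card_fun, Fintype.card_fin]; push_cast; ring
  · refine Nat.cast_le.mpr (num_le_of_injective
      (fun p : (Fin m → γ) × (Fin m → α) × (Fin m → β) => (p.2.1, p.2.2, p.1)) (by
        rintro ⟨a, b, c⟩ ⟨a', b', c'⟩ h; simp_all) (fun p hp => ?_))
    exact fun i j k => hp k j i

/-- A dense tripartite relation on a large set contains a large complete tripartite one. -/
lemma exists_complete_tripartite (m : ℕ) (d : ℝ) (hd : 0 < d) :
    ∃ s₀ : ℕ, ∀ s, s₀ ≤ s → ∀ T : Fin s → Fin s → Fin s → Prop,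
      d * (s : ℝ) ^ 3 ≤ num (fun p : Fin s × Fin s × Fin s => T p.1 p.2.1 p.2.2) →
      ∃ g : Fin 3 → Fin m → Fin s, (∀ i, Function.Injective (g i)) ∧
        ∀ i j k, T (g 0 i) (g 1 j) (g 2 k) := by
  obtain ⟨s₀, hs₀⟩ := exists_nat_gt ((3 * (m : ℝ) ^ 2 + 1) / d ^ (m ^ 3))
  refine ⟨s₀ + 1, fun s hs T hT => ?_⟩
  have hs1 : (0 : ℝ) < s := by exact_mod_cast (by omega : 0 < s)
  have hbig : 3 * (m : ℝ) ^ 2 + 1 < d ^ (m ^ 3) * s := by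
    have : (s₀ : ℝ) ≤ s := by exact_mod_cast (by omega : s₀ ≤ s)
    have h := hs₀.trans_le this
    rwa [div_lt_iff₀ (by positivity), mul_comm (s : ℝ)] at h
  have h1 := blowup_three T m d hd.le (by simpa [pow_succ, mul_assoc] using hT)
  simp only [Fintype.card_fin] at h1
  let F := Fin m → Fin s
  have hF : Fintype.card F = s ^ m := by simp [F]
  have hni := num_not_injective_mul_le (ι := Fin m) (α := Fin s)
  simp only [Fintype.card_fin] at hni
  have hlt : num (fun p : F × F × F => ¬ Function.Injective p.1 ∨ ¬ Function.Injective p.2.1 ∨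
      ¬ Function.Injective p.2.2) < num (fun p : F × F × F =>
        ∀ i j k, T (p.1 i) (p.2.1 j) (p.2.2 k)) := by
    set D := num (fun f : F => ¬ Function.Injective f) with hD
    have a1 : num (fun p : F × F × F => ¬ Function.Injective p.1) = D * (s ^ m) ^ 2 := by
      have := num_and (fun f : F => ¬ Function.Injective f) (fun _ : F × F => True)
      simp only [and_true] at this
      rw [this]
      have : num (fun _ : F × F => True) = (s ^ m) ^ 2 := by simp [num, F, sq]
      rw [this]
    have a2 : num (fun p : F × F × F => ¬ Function.Injective p.2.1) = D * (s ^ m) ^ 2 := by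
      rw [← a1]
      exact num_equiv ((Equiv.prodAssoc F F F).symm.trans
        (((Equiv.prodComm F F).prodCongr (Equiv.refl F)).trans (Equiv.prodAssoc F F F)))
        (fun p : F × F × F => ¬ Function.Injective p.1)
    have a3 : num (fun p : F × F × F => ¬ Function.Injective p.2.2) = D * (s ^ m) ^ 2 := by
      rw [← a1]
      exact num_equiv ((Equiv.prodAssoc F F F).symm.trans (Equiv.prodComm (F × F) F))
        (fun p : F × F × F => ¬ Function.Injective p.1)
    have b1 := num_or_le (fun p : F × F × F => ¬ Function.Injective p.1)
      (fun p => ¬ Function.Injective p.2.1 ∨ ¬ Function.Injective p.2.2)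
    have b2 := num_or_le (fun p : F × F × F => ¬ Function.Injective p.2.1)
      (fun p => ¬ Function.Injective p.2.2)
    have b3 : num (fun p : F × F × F => ¬ Function.Injective p.1 ∨ ¬ Function.Injective p.2.1 ∨
      ¬ Function.Injective p.2.2) ≤ 3 * (D * (s ^ m) ^ 2) := by omega
    refine lt_of_le_of_lt b3 ?_
    have hni' : (D : ℝ) * s ≤ (m : ℝ) ^ 2 * s ^ m := by exact_mod_cast hni
    rw [← Nat.cast_lt (α := ℝ)]
    refine lt_of_lt_of_le ?_ h1
    push_cast
    have hp : (0 : ℝ) < (s : ℝ) ^ m := by positivity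
    refine lt_of_mul_lt_mul_right (a := (s : ℝ)) ?_ hs1.le
    calc 3 * ((D : ℝ) * (s ^ m) ^ 2) * s = 3 * (D * s) * (s ^ m) ^ 2 := by ring
      _ ≤ 3 * ((m : ℝ) ^ 2 * s ^ m) * (s ^ m) ^ 2 := by gcongr
      _ = (3 * (m : ℝ) ^ 2) * (s ^ m) ^ 3 := by ring
      _ < (d ^ m ^ 3 * s) * (s ^ m) ^ 3 := by
          apply mul_lt_mul_of_pos_right (by linarith) (by positivity)
      _ = _ := by ring
  obtain ⟨⟨f, g, h⟩, hT', hinj⟩ := exists_of_lt_num hlt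
  push Not at hinj
  refine ⟨![f, g, h], ?_, ?_⟩
  · intro i
    fin_cases i
    · exact hinj.1
    · exact hinj.2.1
    · exact hinj.2.2
  · exact hT'

end Counting

section FractionalMatching

lemma num_fin_Ico (r a b : ℕ) (hb : b ≤ r) :
    num (fun x : Fin r => a ≤ x.val ∧ x.val < b) = b - a := by
  classical
  unfold num
  rw [← Nat.card_Ico, ← Finset.card_map Fin.valEmbedding]
  congr 1
  ext k
  simp only [Finset.mem_map, Finset.mem_filter, Finset.mem_univ, true_and, Finset.mem_Ico,
    Fin.valEmbedding_apply]
  constructor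
  · rintro ⟨x, hx, rfl⟩
    exact hx
  · intro hk
    exact ⟨⟨k, by omega⟩, hk, rfl⟩

/-- In a weighted set of total weight `rc/3`, at most about `5/9` of the ordered pairs have
weight more than `c`; version for sorted weights. -/
lemma num_heavy_pairs_of_antitone (r : ℕ) (w : Fin r → ℝ) (hw : Antitone w) (h0 : ∀ i, 0 ≤ w i)
    (c : ℝ) (hc : 3 * ∑ i, w i ≤ r * c) :
    (num (fun p : Fin r × Fin r => c < w p.1 + w p.2) : ℝ) ≤ 5 / 9 * (r : ℝ) ^ 2 + 4 * r := by
  have htriv : (num (fun p : Fin r × Fin r => c < w p.1 + w p.2) : ℝ) ≤ (r : ℝ) * r := by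
    have := num_le_card (fun p : Fin r × Fin r => c < w p.1 + w p.2)
    simp only [Fintype.card_prod, Fintype.card_fin] at this
    exact_mod_cast this
  rcases Nat.lt_or_ge r 5 with hr | hr
  · have : (r : ℝ) ≤ 4 := by exact_mod_cast (by omega : r ≤ 4)
    nlinarith [(Nat.cast_nonneg r : (0 : ℝ) ≤ r)]
  obtain ⟨h, hh1, hh2⟩ : ∃ h : ℕ, r ≤ 3 * h ∧ 3 * h ≤ r + 2 := ⟨(r + 2) / 3, by omega, by omega⟩
  have hrpos : (0 : ℝ) < r := by exact_mod_cast (by omega : 0 < r)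
  have hc0 : 0 ≤ c := by
    have : 0 ≤ ∑ i, w i := Finset.sum_nonneg (fun i _ => h0 i)
    by_contra hneg
    nlinarith
  obtain ⟨i, hi, hic⟩ : ∃ i, ∃ hi : i < h, w ⟨i, by omega⟩ + w ⟨2 * h - 1 - i, by omega⟩ ≤ c := by
    by_contra! hcon
    let w' : ℕ → ℝ := fun k => if hk : k < r then w ⟨k, hk⟩ else 0
    have hw0 : ∀ k, 0 ≤ w' k := by
      intro k
      simp only [w']
      split_ifs
      · exact h0 _
      · exact le_rfl
    have e1 : ∑ i, w i = ∑ k ∈ Finset.range r, w' k := by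
      rw [Finset.sum_range]
      exact Finset.sum_congr rfl (fun i _ => by simp [w'])
    have e2 : ∑ k ∈ Finset.range (h + h), w' k ≤ ∑ k ∈ Finset.range r, w' k :=
      Finset.sum_le_sum_of_subset_of_nonneg
        (Finset.range_subset_range.mpr (by omega)) (fun k _ _ => hw0 k)
    rw [Finset.sum_range_add, ← Finset.sum_range_reflect (fun k => w' (h + k)),
      ← Finset.sum_add_distrib] at e2
    have e3 : ∑ k ∈ Finset.range h, c < ∑ k ∈ Finset.range h, (w' k + w' (h + (h - 1 - k))) := by
      refine Finset.sum_lt_sum_of_nonempty (by simp; omega) (fun k hk => ?_)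
      have hk' : k < h := by simpa using hk
      have := hcon k hk'
      have e : h + (h - 1 - k) = 2 * h - 1 - k := by omega
      simp only [w', e]
      rw [dif_pos (by omega), dif_pos (by omega)]
      exact this
    rw [Finset.sum_const, Finset.card_range, nsmul_eq_mul] at e3
    have : (r : ℝ) ≤ 3 * h := by exact_mod_cast hh1
    nlinarith
  set b := 2 * h - 1 - i with hb
  have hcover : num (fun p : Fin r × Fin r => c < w p.1 + w p.2) ≤
      num (fun p : Fin r × Fin r => ((0 ≤ p.1.val ∧ p.1.val < i) ∧ (0 ≤ p.2.val ∧ p.2.val < r)) ∨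
        ((i ≤ p.1.val ∧ p.1.val < r) ∧ (0 ≤ p.2.val ∧ p.2.val < i)) ∨
        ((i ≤ p.1.val ∧ p.1.val < b) ∧ (i ≤ p.2.val ∧ p.2.val < b))) := by
    refine num_mono ?_
    rintro ⟨x, y⟩ hxy
    simp only at hxy ⊢
    by_contra hneg
    have hx := x.isLt
    have hy := y.isLt
    have : (i ≤ x.val ∧ b ≤ y.val) ∨ (i ≤ y.val ∧ b ≤ x.val) := by omega
    rcases this with ⟨h1, h2⟩ | ⟨h1, h2⟩
    · have a1 : w x ≤ w ⟨i, by omega⟩ := hw (by simpa [Fin.le_def] using h1)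
      have a2 : w y ≤ w ⟨b, by omega⟩ := hw (by simpa [Fin.le_def] using h2)
      linarith
    · have a1 : w y ≤ w ⟨i, by omega⟩ := hw (by simpa [Fin.le_def] using h1)
      have a2 : w x ≤ w ⟨b, by omega⟩ := hw (by simpa [Fin.le_def] using h2)
      linarith
  have b1 := num_or_le
    (fun p : Fin r × Fin r => (0 ≤ p.1.val ∧ p.1.val < i) ∧ (0 ≤ p.2.val ∧ p.2.val < r))
    (fun p => ((i ≤ p.1.val ∧ p.1.val < r) ∧ (0 ≤ p.2.val ∧ p.2.val < i)) ∨
        ((i ≤ p.1.val ∧ p.1.val < b) ∧ (i ≤ p.2.val ∧ p.2.val < b)))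
  have b2 := num_or_le
    (fun p : Fin r × Fin r => (i ≤ p.1.val ∧ p.1.val < r) ∧ (0 ≤ p.2.val ∧ p.2.val < i))
    (fun p => (i ≤ p.1.val ∧ p.1.val < b) ∧ (i ≤ p.2.val ∧ p.2.val < b))
  rw [num_and (fun x : Fin r => 0 ≤ x.val ∧ x.val < i) (fun x : Fin r => 0 ≤ x.val ∧ x.val < r),
    num_fin_Ico _ _ _ (by omega), num_fin_Ico _ _ _ (by omega)] at b1
  rw [num_and (fun x : Fin r => i ≤ x.val ∧ x.val < r) (fun x : Fin r => 0 ≤ x.val ∧ x.val < i),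
    num_and (fun x : Fin r => i ≤ x.val ∧ x.val < b) (fun x : Fin r => i ≤ x.val ∧ x.val < b),
    num_fin_Ico _ _ _ (by omega), num_fin_Ico _ _ _ (by omega),
    num_fin_Ico _ _ _ (by omega)] at b2
  have hfin : num (fun p : Fin r × Fin r => c < w p.1 + w p.2) ≤
      i * r + ((r - i) * i + (b - i) * (b - i)) := by
    simp only [Nat.sub_zero] at b1 b2
    omega
  obtain ⟨j, hj⟩ : ∃ j, h = i + 1 + j := ⟨h - i - 1, by omega⟩
  obtain ⟨l, hl⟩ : ∃ l, r = i + l := ⟨r - i, by omega⟩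
  have e1 : b - i = 2 * j + 1 := by omega
  have e2 : r - i = l := by omega
  rw [e1, e2] at hfin
  have hfin' : (num (fun p : Fin r × Fin r => c < w p.1 + w p.2) : ℝ) ≤
      i * r + (l * i + (2 * j + 1) * (2 * j + 1)) := by exact_mod_cast hfin
  refine hfin'.trans ?_
  have c1 : 3 * ((i : ℝ) + 1 + j) ≤ r + 2 := by exact_mod_cast (hj ▸ hh2)
  have c2 : (r : ℝ) = i + l := by exact_mod_cast hl
  have hj0 : (0 : ℝ) ≤ j := Nat.cast_nonneg j
  have hi0 : (0 : ℝ) ≤ i := Nat.cast_nonneg i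
  have c3 : (l : ℝ) = r - i := by linarith
  rw [c3]
  have k1 : (j : ℝ) ≤ (r - 1) / 3 - i := by linarith
  have k2 : (i : ℝ) ≤ (r - 1) / 3 := by linarith
  have k3 : (2 * (j : ℝ) + 1) * (2 * j + 1) ≤ (2 * ((r - 1) / 3 - i) + 1) ^ 2 := by
    rw [sq]; gcongr
  have k4 : (i : ℝ) * (i - (r - 1) / 3) ≤ 0 :=
    mul_nonpos_of_nonneg_of_nonpos hi0 (by linarith)
  nlinarith

lemma num_heavy_pairs {ι : Type*} [Fintype ι] (w : ι → ℝ) (h0 : ∀ i, 0 ≤ w i)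
    (c : ℝ) (hc : 3 * ∑ i, w i ≤ Fintype.card ι * c) :
    (num (fun p : ι × ι => c < w p.1 + w p.2) : ℝ) ≤
      5 / 9 * (Fintype.card ι : ℝ) ^ 2 + 4 * Fintype.card ι := by
  let e := (Fintype.equivFin ι).symm
  let σ := Tuple.sort (fun i => - w (e i))
  let e' := σ.trans e
  have hanti : Antitone (fun i => w (e' i)) := by
    intro a b hab
    have := Tuple.monotone_sort (fun i => - w (e i)) hab
    simp only [Function.comp] at this
    simp only [e', Equiv.trans_apply, σ]
    linarith
  have := num_heavy_pairs_of_antitone _ (fun i => w (e' i)) hanti (fun i => h0 _) c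
    (by rw [Equiv.sum_comp e' w]; exact hc)
  rw [← num_equiv (e'.prodCongr e') (fun p : ι × ι => c < w p.1 + w p.2)]
  simpa using this

/-- The fractional matching lemma: large minimum degree puts the barycentre into the convex hull
of the edge vectors. -/
lemma const_mem_convexHull {ι : Type} [Fintype ι] [DecidableEq ι] [Nonempty ι]
    (T : ι → ι → ι → Prop)
    (hT : ∀ i, 5 / 9 * (Fintype.card ι : ℝ) ^ 2 + 4 * Fintype.card ι <
      num (fun p : ι × ι => T i p.1 p.2)) :
    (fun _ : ι => 3 / (Fintype.card ι : ℝ)) ∈ convexHull ℝ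
      {f : ι → ℝ | ∃ i j k, T i j k ∧
        f = Pi.single i 1 + Pi.single j 1 + Pi.single k 1} := by
  set S := {f : ι → ℝ | ∃ i j k, T i j k ∧
        f = Pi.single i 1 + Pi.single j 1 + Pi.single k 1} with hS
  have hfin : S.Finite := by
    refine Set.Finite.subset (Set.finite_range (fun p : ι × ι × ι =>
      (Pi.single p.1 1 + Pi.single p.2.1 1 + Pi.single p.2.2 1 : ι → ℝ))) ?_
    rintro f ⟨i, j, k, _, rfl⟩
    exact ⟨(i, j, k), rfl⟩
  by_contra hcon
  obtain ⟨φ, u, h1, h2⟩ := geometric_hahn_banach_point_closed (convex_convexHull ℝ S)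
    (hfin.isCompact_convexHull ℝ).isClosed hcon
  set w : ι → ℝ := fun i => φ (Pi.single i 1) with hw
  have hr : (0 : ℝ) < Fintype.card ι := by exact_mod_cast Fintype.card_pos
  have e1 : φ (fun _ : ι => 3 / (Fintype.card ι : ℝ)) = 3 / (Fintype.card ι : ℝ) * ∑ i, w i := by
    have : (fun _ : ι => 3 / (Fintype.card ι : ℝ)) =
        ∑ i, (3 / (Fintype.card ι : ℝ)) • (Pi.single i 1 : ι → ℝ) := by
      funext j
      simp [Finset.sum_apply, Pi.single_apply]
    rw [this, map_sum, Finset.mul_sum]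
    exact Finset.sum_congr rfl (fun i _ => by rw [map_smul, smul_eq_mul])
  obtain ⟨v, hv⟩ := Finite.exists_min w
  have key := num_heavy_pairs (fun i => w i - w v) (fun i => by linarith [hv i])
    (3 / (Fintype.card ι : ℝ) * ∑ i, (w i - w v)) (le_of_eq (by field_simp))
  refine absurd (hT v) (not_lt.mpr (le_trans ?_ key))
  refine Nat.cast_le.mpr (num_mono ?_)
  rintro ⟨j, k⟩ hjk
  have h3 := h2 _ (subset_convexHull ℝ S ⟨v, j, k, hjk, rfl⟩)
  rw [map_add, map_add] at h3
  rw [e1] at h1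
  simp only at hjk ⊢
  rw [Finset.sum_sub_distrib, Finset.sum_const, Finset.card_univ, nsmul_eq_mul, mul_sub]
  have : 3 / (Fintype.card ι : ℝ) * (Fintype.card ι * w v) = 3 * w v := by field_simp
  rw [this]
  have : u < w v + w j + w k := h3
  linarith

/-- A perfect fractional matching with small support. -/
lemma exists_fractional_matching {ι : Type} [Fintype ι] [DecidableEq ι] [Nonempty ι]
    (T : ι → ι → ι → Prop)
    (hT : ∀ i, 5 / 9 * (Fintype.card ι : ℝ) ^ 2 + 4 * Fintype.card ι <
      num (fun p : ι × ι => T i p.1 p.2)) :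
    ∃ (κ : Type) (_ : Fintype κ) (e : κ → Fin 3 → ι) (x : κ → ℝ),
      Fintype.card κ ≤ Fintype.card ι + 1 ∧ (∀ a, T (e a 0) (e a 1) (e a 2)) ∧
      (∀ a, 0 ≤ x a) ∧
      ∀ i, ∑ a, x a * ∑ p : Fin 3, (if e a p = i then 1 else 0) = 1 := by
  obtain ⟨κ, hκ, z, w, hz, haff, hw, hw1, hsum⟩ :=
    eq_pos_convex_span_of_mem_convexHull (const_mem_convexHull T hT)
  have hz' : ∀ a, ∃ i j k, T i j k ∧ z a = Pi.single i 1 + Pi.single j 1 + Pi.single k 1 :=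
    fun a => hz (Set.mem_range_self a)
  choose i j k hT' hzz using hz'
  have hr : (0 : ℝ) < Fintype.card ι := by exact_mod_cast Fintype.card_pos
  let e0 := Fintype.equivFin κ
  refine ⟨Fin (Fintype.card κ), inferInstance, fun a => ![i (e0.symm a), j (e0.symm a), k (e0.symm a)],
    fun a => Fintype.card ι / 3 * w (e0.symm a), ?_, ?_, ?_, ?_⟩
  · have := haff.card_le_finrank_succ
    have h2 := Submodule.finrank_le (vectorSpan ℝ (Set.range z))
    rw [Module.finrank_fintype_fun_eq_card] at h2
    simp only [Fintype.card_fin]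
    omega
  · intro a
    exact hT' _
  · intro a
    have := (hw (e0.symm a)).le
    positivity
  · intro v
    have h3 := congrFun hsum v
    rw [Finset.sum_apply] at h3
    rw [Equiv.sum_comp e0.symm (fun a => Fintype.card ι / 3 * w a *
      ∑ p : Fin 3, (if (![i a, j a, k a] : Fin 3 → ι) p = v then (1 : ℝ) else 0))]
    have h4 : ∀ a, Fintype.card ι / 3 * w a *
      ∑ p : Fin 3, (if (![i a, j a, k a] : Fin 3 → ι) p = v then (1 : ℝ) else 0) =
        Fintype.card ι / 3 * (w a • z a) v := by
      intro a
      rw [hzz a, Fin.sum_univ_three]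
      simp [Pi.single_apply, eq_comm]
      ring
    rw [Finset.sum_congr rfl (fun a _ => h4 a), ← Finset.mul_sum, h3]
    field_simp

end FractionalMatching

section AlmostTiling

/-- A family of vertex-disjoint complete tripartite subgraphs with parts of size `s`, indexed
by `β`. -/
def IsTiling {V β : Type*} (R : V → V → V → Prop) (s : ℕ) (τ : β × Fin 3 × Fin s → V) : Prop :=
  Function.Injective τ ∧ ∀ b i j k, R (τ (b, 0, i)) (τ (b, 1, j)) (τ (b, 2, k))

lemma num_used_le {ι β : Type*} [Fintype ι] [DecidableEq ι] [Fintype β] {s t : ℕ}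
    (e : β → Fin 3 → ι) (σ : β → Fin 3 → Fin t → Fin s) (i : ι) (q : β → Prop) :
    num (fun x : Fin s => ∃ b, q b ∧ ∃ p a, e b p = i ∧ σ b p a = x) ≤
      t * num (fun y : β × Fin 3 => e y.1 y.2 = i) := by
  have h2 : num (fun y : (β × Fin 3) × Fin t => e y.1.1 y.1.2 = i ∧ True) =
      num (fun y : β × Fin 3 => e y.1 y.2 = i) * t := by
    rw [num_and (fun y : β × Fin 3 => e y.1 y.2 = i) (fun _ : Fin t => True)]
    simp [num]
  rw [mul_comm, ← h2]
  have hch : ∀ x : {x : Fin s // ∃ b, q b ∧ ∃ p a, e b p = i ∧ σ b p a = x},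
      ∃ y : (β × Fin 3) × Fin t, e y.1.1 y.1.2 = i ∧ σ y.1.1 y.1.2 y.2 = x.1 := by
    rintro ⟨x, b, -, p, a, h1, h2⟩
    exact ⟨((b, p), a), h1, h2⟩
  choose f hf1 hf2 using hch
  classical
  unfold num
  rw [← Fintype.card_subtype, ← Fintype.card_subtype]
  refine Fintype.card_le_of_injective (fun x => ⟨f x, hf1 x, trivial⟩) ?_
  intro x y hxy
  simp only [Subtype.mk.injEq] at hxy
  apply Subtype.ext
  rw [← hf2, ← hf2, hxy]

/-- Disjoint complete tripartite graphs can be packed greedily into prescribed dense triples of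
parts as long as no part gets too full. -/
lemma exists_packing {ι β : Type*} [Fintype ι] [DecidableEq ι] [Fintype β] {s t : ℕ}
    (T : ι → ι → ι → Fin s → Fin s → Fin s → Prop) (d η : ℝ) (hη : 3 * η ≤ d / 2)
    (hs : ∀ T' : Fin s → Fin s → Fin s → Prop,
      d / 2 * (s : ℝ) ^ 3 ≤ num (fun p : Fin s × Fin s × Fin s => T' p.1 p.2.1 p.2.2) →
      ∃ g : Fin 3 → Fin t → Fin s, (∀ i, Function.Injective (g i)) ∧
        ∀ i j k, T' (g 0 i) (g 1 j) (g 2 k))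
    (e : β → Fin 3 → ι) (he : ∀ b, Function.Injective (e b))
    (hd : ∀ b, d * (s : ℝ) ^ 3 ≤ num (fun p : Fin s × Fin s × Fin s =>
      T (e b 0) (e b 1) (e b 2) p.1 p.2.1 p.2.2))
    (hload : ∀ i, (t : ℝ) * num (fun y : β × Fin 3 => e y.1 y.2 = i) ≤ η * s) :
    ∃ σ : β → Fin 3 → Fin t → Fin s,
      (∀ b i j k, T (e b 0) (e b 1) (e b 2) (σ b 0 i) (σ b 1 j) (σ b 2 k)) ∧
      Function.Injective (fun y : β × Fin 3 × Fin t => (e y.1 y.2.1, σ y.1 y.2.1 y.2.2)) := by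
  classical
  suffices h : ∀ B : Finset β, ∃ σ : β → Fin 3 → Fin t → Fin s,
      (∀ b ∈ B, ∀ i j k, T (e b 0) (e b 1) (e b 2) (σ b 0 i) (σ b 1 j) (σ b 2 k)) ∧
      ∀ b ∈ B, ∀ b' ∈ B, ∀ p p' a a', e b p = e b' p' → σ b p a = σ b' p' a' →
        b = b' ∧ p = p' ∧ a = a' by
    obtain ⟨σ, h1, h2⟩ := h Finset.univ
    refine ⟨σ, fun b => h1 b (Finset.mem_univ _), ?_⟩
    rintro ⟨b, p, a⟩ ⟨b', p', a'⟩ hh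
    simp only [Prod.mk.injEq] at hh
    obtain ⟨rfl, rfl, rfl⟩ := h2 b (Finset.mem_univ _) b' (Finset.mem_univ _) _ _ _ _ hh.1 hh.2
    rfl
  intro B
  induction B using Finset.induction_on with
  | empty =>
    rcases isEmpty_or_nonempty β with hβ | ⟨⟨b⟩⟩
    · exact ⟨fun b => (hβ.false b).elim, by simp, by simp⟩
    · obtain ⟨g, -, -⟩ := hs (T (e b 0) (e b 1) (e b 2)) (le_trans (by
        have : 0 ≤ num (fun y : β × Fin 3 => e y.1 y.2 = e b 0) := Nat.zero_le _
        have h0 := hload (e b 0)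
        have h1 : 0 ≤ η * s := le_trans (by positivity) h0
        have h2 : 0 ≤ d * s := by nlinarith
        have h3 : 0 ≤ d * s * (s : ℝ) ^ 2 := by positivity
        nlinarith) (hd b))
      exact ⟨fun _ => g, by simp, by simp⟩
  | insert b₀ B hb₀ ih =>
    obtain ⟨σ, h1, h2⟩ := ih
    let U : ι → Fin s → Prop := fun i x => ∃ b, b ∈ B ∧ ∃ p a, e b p = i ∧ σ b p a = x
    have hU : ∀ i, (num (U i) : ℝ) ≤ η * s := by
      intro i
      refine le_trans ?_ (hload i)
      exact_mod_cast num_used_le e σ i (fun b => b ∈ B)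
    obtain ⟨g, hg1, hg2⟩ := hs (fun x y z => T (e b₀ 0) (e b₀ 1) (e b₀ 2) x y z ∧
      ¬ U (e b₀ 0) x ∧ ¬ U (e b₀ 1) y ∧ ¬ U (e b₀ 2) z) (by
        have k0 := hd b₀
        have k1 : num (fun p : Fin s × Fin s × Fin s =>
            T (e b₀ 0) (e b₀ 1) (e b₀ 2) p.1 p.2.1 p.2.2) ≤
            num (fun p : Fin s × Fin s × Fin s =>
              (T (e b₀ 0) (e b₀ 1) (e b₀ 2) p.1 p.2.1 p.2.2 ∧
              ¬ U (e b₀ 0) p.1 ∧ ¬ U (e b₀ 1) p.2.1 ∧ ¬ U (e b₀ 2) p.2.2) ∨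
              (U (e b₀ 0) p.1 ∧ True) ∨ (True ∧ (U (e b₀ 1) p.2.1 ∧ True)) ∨
              (True ∧ (True ∧ U (e b₀ 2) p.2.2))) := by
          refine num_mono (fun p hp => ?_)
          by_cases c0 : U (e b₀ 0) p.1
          · exact Or.inr (Or.inl ⟨c0, trivial⟩)
          by_cases c1 : U (e b₀ 1) p.2.1
          · exact Or.inr (Or.inr (Or.inl ⟨trivial, c1, trivial⟩))
          by_cases c2 : U (e b₀ 2) p.2.2
          · exact Or.inr (Or.inr (Or.inr ⟨trivial, trivial, c2⟩))
          exact Or.inl ⟨hp, c0, c1, c2⟩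
        have k2 := num_or_le (fun p : Fin s × Fin s × Fin s =>
              T (e b₀ 0) (e b₀ 1) (e b₀ 2) p.1 p.2.1 p.2.2 ∧
              ¬ U (e b₀ 0) p.1 ∧ ¬ U (e b₀ 1) p.2.1 ∧ ¬ U (e b₀ 2) p.2.2) (fun p =>
              (U (e b₀ 0) p.1 ∧ True) ∨ (True ∧ (U (e b₀ 1) p.2.1 ∧ True)) ∨
              (True ∧ (True ∧ U (e b₀ 2) p.2.2)))
        have k3 := num_or_le (fun p : Fin s × Fin s × Fin s => U (e b₀ 0) p.1 ∧ True) (fun p =>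
              (True ∧ (U (e b₀ 1) p.2.1 ∧ True)) ∨ (True ∧ (True ∧ U (e b₀ 2) p.2.2)))
        have k4 := num_or_le (fun p : Fin s × Fin s × Fin s =>
              True ∧ (U (e b₀ 1) p.2.1 ∧ True)) (fun p => True ∧ (True ∧ U (e b₀ 2) p.2.2))
        rw [num_and (U (e b₀ 0)) (fun _ : Fin s × Fin s => True)] at k3
        rw [num_and (fun _ : Fin s => True) (fun q : Fin s × Fin s => U (e b₀ 1) q.1 ∧ True),
          num_and (U (e b₀ 1)) (fun _ : Fin s => True),
          num_and (fun _ : Fin s => True) (fun q : Fin s × Fin s => True ∧ U (e b₀ 2) q.2),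
          num_and (fun _ : Fin s => True) (U (e b₀ 2))] at k4
        have t1 : num (fun _ : Fin s => True) = s := by simp [num]
        have t2 : num (fun _ : Fin s × Fin s => True) = s * s := by simp [num]
        rw [t2] at k3
        rw [t1] at k4
        have k5 := (((k1.trans k2).trans (Nat.add_le_add_left k3 _)).trans
          (Nat.add_le_add_left (Nat.add_le_add_left k4 _) _))
        rw [← Nat.cast_le (α := ℝ)] at k5
        push_cast at k5
        have u0 := hU (e b₀ 0)
        have u1 := hU (e b₀ 1)
        have u2 := hU (e b₀ 2)
        have hs0 : (0 : ℝ) ≤ (s : ℝ) * s := by positivity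
        have v0 := mul_le_mul_of_nonneg_right u0 hs0
        have v1 := mul_le_mul_of_nonneg_right u1 hs0
        have v2 := mul_le_mul_of_nonneg_right u2 hs0
        have v3 := mul_le_mul_of_nonneg_right hη (by positivity : (0 : ℝ) ≤ (s : ℝ) ^ 3)
        nlinarith)
    have hgU : ∀ p a, ¬ U (e b₀ p) (g p a) := by
      intro p a
      have := (hg2 a a a).2
      fin_cases p
      · exact this.1
      · exact this.2.1
      · exact this.2.2
    have hB : ∀ b ∈ B, Function.update σ b₀ g b = σ b := fun b hb =>
      Function.update_of_ne (ne_of_mem_of_not_mem hb hb₀) _ _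
    have hb₀' : Function.update σ b₀ g b₀ = g := Function.update_self _ _ _
    refine ⟨Function.update σ b₀ g, ?_, ?_⟩
    · intro b hb i j k
      rcases Finset.mem_insert.mp hb with hbe | hbB
      · subst hbe
        rw [hb₀']
        exact (hg2 i j k).1
      · rw [hB b hbB]
        exact h1 b hbB i j k
    · intro b hb b' hb' p p' a a' hep hσ
      rcases Finset.mem_insert.mp hb with hbe | hbB <;>
      rcases Finset.mem_insert.mp hb' with hbe' | hbB'
      · subst hbe
        subst hbe'
        obtain rfl := he _ hep
        rw [hb₀'] at hσ
        exact ⟨rfl, rfl, hg1 _ hσ⟩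
      · subst hbe
        rw [hb₀', hB b' hbB'] at hσ
        exact absurd ⟨b', hbB', p', a', hep.symm, hσ.symm⟩ (hgU p a)
      · subst hbe'
        rw [hb₀', hB b hbB] at hσ
        exact absurd ⟨b, hbB, p, a, hep, hσ⟩ (hgU p' a')
      · rw [hB b hbB, hB b' hbB'] at hσ
        exact h2 b hbB b' hbB' p p' a a' hep hσ

/-- The reduced graph inherits the minimum degree. -/
lemma reduced_degree {V ι : Type} [Fintype V] [Fintype ι] {s : ℕ}
    (hs : 1 ≤ s) (R : V → V → V → Prop) (π : ι × Fin s → V) (hπ : Function.Injective π)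
    (hn : Fintype.card V ≤ Fintype.card ι * s + s) (c d : ℝ) (hc : 0 ≤ c) (hd : 0 ≤ d)
    (hR : ∀ x, c * (Fintype.card V : ℝ) ^ 2 ≤ num (fun p : V × V => R x p.1 p.2)) (i : ι) :
    c * (Fintype.card ι : ℝ) ^ 2 ≤ 2 * (Fintype.card ι + 1) + d * (Fintype.card ι : ℝ) ^ 2 +
      3 * Fintype.card ι +
      num (fun q : ι × ι => (i ≠ q.1 ∧ i ≠ q.2 ∧ q.1 ≠ q.2) ∧
        d * (s : ℝ) ^ 3 ≤ num (fun p : Fin s × Fin s × Fin s =>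
          R (π (i, p.1)) (π (q.1, p.2.1)) (π (q.2, p.2.2)))) := by
  classical
  set n := Fintype.card V with hnV
  set r := Fintype.card ι with hrI
  set D := num (fun q : ι × ι => (i ≠ q.1 ∧ i ≠ q.2 ∧ q.1 ≠ q.2) ∧
        d * (s : ℝ) ^ 3 ≤ num (fun p : Fin s × Fin s × Fin s =>
          R (π (i, p.1)) (π (q.1, p.2.1)) (π (q.2, p.2.2)))) with hD
  have hrs : r * s ≤ n := by
    have := Fintype.card_le_of_injective π hπ
    simpa [hrI, hnV] using this
  have : Nonempty (ι × Fin s) := ⟨(i, ⟨0, hs⟩)⟩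
  let inv := Function.invFun π
  have hinv : ∀ y, (∃ q, π q = y) → π (inv y) = y := fun y hy => Function.invFun_eq hy
  have hout : num (fun y : V => ¬ ∃ q, π q = y) ≤ s := by
    have h1 := num_add_num_not (fun y : V => ∃ q, π q = y)
    have h2 : num (fun _ : ι × Fin s => True) ≤ num (fun y : V => ∃ q, π q = y) :=
      num_le_of_injective π hπ (fun q _ => ⟨q, rfl⟩)
    have h3 : num (fun _ : ι × Fin s => True) = r * s := by simp [num, hrI]
    omega
  have hX : num (fun p : Fin s × V × V => R (π (i, p.1)) p.2.1 p.2.2) ≤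
      s * (s * n) + s * (n * s) + ∑ q : ι × ι, num (fun p : Fin s × Fin s × Fin s =>
          R (π (i, p.1)) (π (q.1, p.2.1)) (π (q.2, p.2.2))) := by
    have k1 : num (fun p : Fin s × V × V => R (π (i, p.1)) p.2.1 p.2.2) ≤
        num (fun p : Fin s × V × V => (True ∧ ((¬ ∃ q, π q = p.2.1) ∧ True)) ∨
          (True ∧ (True ∧ ¬ ∃ q, π q = p.2.2)) ∨
          (R (π (i, p.1)) p.2.1 p.2.2 ∧ (∃ q, π q = p.2.1) ∧ (∃ q, π q = p.2.2))) :=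
      num_mono (fun p hp => by tauto)
    have k2 := num_or_le (fun p : Fin s × V × V => True ∧ ((¬ ∃ q, π q = p.2.1) ∧ True))
      (fun p => (True ∧ (True ∧ ¬ ∃ q, π q = p.2.2)) ∨
          (R (π (i, p.1)) p.2.1 p.2.2 ∧ (∃ q, π q = p.2.1) ∧ (∃ q, π q = p.2.2)))
    have k3 := num_or_le (fun p : Fin s × V × V => True ∧ (True ∧ ¬ ∃ q, π q = p.2.2))
      (fun p => R (π (i, p.1)) p.2.1 p.2.2 ∧ (∃ q, π q = p.2.1) ∧ (∃ q, π q = p.2.2))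
    rw [num_and (fun _ : Fin s => True) (fun p : V × V => (¬ ∃ q, π q = p.1) ∧ True),
      num_and (fun y : V => ¬ ∃ q, π q = y) (fun _ : V => True)] at k2
    rw [num_and (fun _ : Fin s => True) (fun p : V × V => True ∧ ¬ ∃ q, π q = p.2),
      num_and (fun _ : V => True) (fun y : V => ¬ ∃ q, π q = y)] at k3
    have t1 : num (fun _ : Fin s => True) = s := by simp [num]
    have t2 : num (fun _ : V => True) = n := by simp [num, hnV]
    rw [t1, t2] at k2 k3
    have k4 : num (fun p : Fin s × V × V => R (π (i, p.1)) p.2.1 p.2.2 ∧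
        (∃ q, π q = p.2.1) ∧ (∃ q, π q = p.2.2)) ≤
        num (fun z : (ι × ι) × (Fin s × Fin s × Fin s) =>
          R (π (i, z.2.1)) (π (z.1.1, z.2.2.1)) (π (z.1.2, z.2.2.2))) := by
      refine num_le_of_injOn (fun p : Fin s × V × V =>
        (((inv p.2.1).1, (inv p.2.2).1), (p.1, (inv p.2.1).2, (inv p.2.2).2))) ?_ ?_
      · rintro ⟨a, y, z⟩ ⟨a', y', z'⟩ ⟨-, hy, hz⟩ ⟨-, hy', hz'⟩ h
        simp only [Prod.mk.injEq] at h hy hz hy' hz' ⊢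
        refine ⟨h.2.1, ?_, ?_⟩
        · rw [← hinv y hy, ← hinv y' hy', Prod.ext h.1.1 h.2.2.1]
        · rw [← hinv z hz, ← hinv z' hz', Prod.ext h.1.2 h.2.2.2]
      · rintro ⟨a, y, z⟩ ⟨h, hy, hz⟩
        simp only [Prod.mk.eta] at h hy hz ⊢
        rwa [hinv y hy, hinv z hz]
    rw [num_prod (fun (q : ι × ι) (p : Fin s × Fin s × Fin s) =>
      R (π (i, p.1)) (π (q.1, p.2.1)) (π (q.2, p.2.2)))] at k4
    have k5 : s * (num (fun y : V => ¬ ∃ q, π q = y) * n) ≤ s * (s * n) := by gcongr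
    have k6 : s * (n * num (fun y : V => ¬ ∃ q, π q = y)) ≤ s * (n * s) := by gcongr
    omega
  have hlow : (s : ℝ) * (c * (n : ℝ) ^ 2) ≤
      num (fun p : Fin s × V × V => R (π (i, p.1)) p.2.1 p.2.2) := by
    rw [num_prod (fun (a : Fin s) (p : V × V) => R (π (i, a)) p.1 p.2)]
    push_cast
    calc (s : ℝ) * (c * (n : ℝ) ^ 2) = ∑ _a : Fin s, c * (n : ℝ) ^ 2 := by simp
      _ ≤ _ := Finset.sum_le_sum (fun a _ => hR _)
  have hsum : (∑ q : ι × ι, num (fun p : Fin s × Fin s × Fin s =>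
          R (π (i, p.1)) (π (q.1, p.2.1)) (π (q.2, p.2.2))) : ℝ) ≤
      (s : ℝ) ^ 3 * (D + d * r ^ 2 + 3 * r) := by
    have e0 : (D : ℝ) = ∑ q : ι × ι, (if (i ≠ q.1 ∧ i ≠ q.2 ∧ q.1 ≠ q.2) ∧
        d * (s : ℝ) ^ 3 ≤ num (fun p : Fin s × Fin s × Fin s =>
          R (π (i, p.1)) (π (q.1, p.2.1)) (π (q.2, p.2.2))) then 1 else 0) := by
      rw [hD, num_eq_sum]
      push_cast
      exact Finset.sum_congr rfl (fun q _ => by congr)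
    have e1 : (r : ℝ) = ∑ q : ι × ι, (if i = q.1 then 1 else 0) := by
      rw [Fintype.sum_prod_type_right]
      simp [hrI]
    have e2 : (r : ℝ) = ∑ q : ι × ι, (if i = q.2 then 1 else 0) := by
      rw [Fintype.sum_prod_type]
      simp [hrI]
    have e3 : (r : ℝ) = ∑ q : ι × ι, (if q.1 = q.2 then 1 else 0) := by
      rw [Fintype.sum_prod_type]
      simp [hrI]
    have e4 : d * (r : ℝ) ^ 2 = ∑ q : ι × ι, d := by
      simp [hrI]
      ring
    have e5 : (D : ℝ) + d * r ^ 2 + 3 * r = ∑ q : ι × ι,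
        ((if (i ≠ q.1 ∧ i ≠ q.2 ∧ q.1 ≠ q.2) ∧
        d * (s : ℝ) ^ 3 ≤ num (fun p : Fin s × Fin s × Fin s =>
          R (π (i, p.1)) (π (q.1, p.2.1)) (π (q.2, p.2.2))) then 1 else 0) + d +
        ((if i = q.1 then 1 else 0) + (if i = q.2 then 1 else 0) +
          (if q.1 = q.2 then 1 else 0))) := by
      rw [Finset.sum_add_distrib, Finset.sum_add_distrib, Finset.sum_add_distrib,
        Finset.sum_add_distrib, ← e0, ← e1, ← e2, ← e3, ← e4]
      ring
    rw [e5, Finset.mul_sum]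
    refine Finset.sum_le_sum (fun q _ => ?_)
    have htriv : (num (fun p : Fin s × Fin s × Fin s =>
          R (π (i, p.1)) (π (q.1, p.2.1)) (π (q.2, p.2.2))) : ℝ) ≤ (s : ℝ) ^ 3 := by
      have := num_le_card (fun p : Fin s × Fin s × Fin s =>
          R (π (i, p.1)) (π (q.1, p.2.1)) (π (q.2, p.2.2)))
      simp only [Fintype.card_prod, Fintype.card_fin] at this
      calc _ ≤ ((s * (s * s) : ℕ) : ℝ) := by exact_mod_cast this
        _ = _ := by push_cast; ring
    generalize (num (fun p : Fin s × Fin s × Fin s =>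
          R (π (i, p.1)) (π (q.1, p.2.1)) (π (q.2, p.2.2))) : ℝ) = w at htriv ⊢
    have hs3 : (0 : ℝ) ≤ (s : ℝ) ^ 3 := by positivity
    have hi : ∀ (P : Prop) [Decidable P], (0 : ℝ) ≤ if P then 1 else 0 := by
      intro P _
      split_ifs <;> simp
    have g0 := hi ((i ≠ q.1 ∧ i ≠ q.2 ∧ q.1 ≠ q.2) ∧ d * (s : ℝ) ^ 3 ≤ w)
    have g1 := hi (i = q.1)
    have g2 := hi (i = q.2)
    have g3 := hi (q.1 = q.2)
    by_cases hall : (i ≠ q.1 ∧ i ≠ q.2 ∧ q.1 ≠ q.2) ∧ ¬ d * (s : ℝ) ^ 3 ≤ w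
    · have hw := le_of_lt (not_le.mp hall.2)
      refine hw.trans ?_
      exact (mul_comm _ _).trans_le (mul_le_mul_of_nonneg_left (by linarith) hs3)
    · refine htriv.trans (le_mul_of_one_le_right hs3 ?_)
      by_cases c1 : i = q.1
      · rw [if_pos c1]
        linarith
      by_cases c2 : i = q.2
      · rw [if_pos c2]
        linarith
      by_cases c3 : q.1 = q.2
      · rw [if_pos c3]
        linarith
      rw [if_pos ⟨⟨c1, c2, c3⟩, not_not.mp (fun h => hall ⟨⟨c1, c2, c3⟩, h⟩)⟩]
      linarith
  have hX' : (num (fun p : Fin s × V × V => R (π (i, p.1)) p.2.1 p.2.2) : ℝ) ≤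
      s * (s * n) + s * (n * s) + ∑ q : ι × ι, num (fun p : Fin s × Fin s × Fin s =>
          R (π (i, p.1)) (π (q.1, p.2.1)) (π (q.2, p.2.2))) := by exact_mod_cast hX
  push_cast at hX'
  have hspos : (0 : ℝ) < s := by exact_mod_cast hs
  have hrs' : (r : ℝ) * s ≤ n := by exact_mod_cast hrs
  have hn' : (n : ℝ) ≤ r * s + s := by exact_mod_cast hn
  have hsq : ((r : ℝ) * s) ^ 2 ≤ (n : ℝ) ^ 2 := pow_le_pow_left₀ (by positivity) hrs' 2
  have f1 : (s : ℝ) * (c * ((r : ℝ) * s) ^ 2) ≤ s * (c * (n : ℝ) ^ 2) := by gcongr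
  have f2 : (s : ℝ) * (s * n) + s * (n * s) ≤ s * (s * (r * s + s)) + s * ((r * s + s) * s) := by
    gcongr
  have f3 : (s : ℝ) ^ 3 * (c * (r : ℝ) ^ 2) ≤
      (s : ℝ) ^ 3 * (2 * (r + 1) + d * (r : ℝ) ^ 2 + 3 * r + D) := by
    nlinarith
  exact le_of_mul_le_mul_left f3 (by positivity)

end AlmostTiling

section AlmostTilingIteration

lemma exists_extend_partition {V β : Type} [Fintype V] [Fintype β] {s : ℕ} (hs : 1 ≤ s)
    (τ : β × Fin 3 × Fin s → V) (hτ : Function.Injective τ) :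
    ∃ (M : ℕ) (π : ((β × Fin 3) ⊕ Fin M) × Fin s → V), Function.Injective π ∧
      (∀ b p a, π (Sum.inl (b, p), a) = τ (b, p, a)) ∧
      Fintype.card V ≤ Fintype.card ((β × Fin 3) ⊕ Fin M) * s + s := by
  classical
  set C := {v : V // v ∉ Set.range τ} with hC
  have hcard : Fintype.card V = Fintype.card β * 3 * s + Fintype.card C := by
    have h1 : Fintype.card {v : V // v ∈ Set.range τ} = Fintype.card β * 3 * s := by
      rw [← Fintype.card_congr (Equiv.ofInjective τ hτ)]
      simp [mul_assoc]
    have h2 : Fintype.card C =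
        Fintype.card V - Fintype.card {v : V // v ∈ Set.range τ} := by
      convert Fintype.card_subtype_compl (fun v : V => v ∈ Set.range τ)
    have := Fintype.card_subtype_le (fun v : V => v ∈ Set.range τ)
    rw [← h1]
    omega
  have hM : Fintype.card (Fin (Fintype.card C / s) × Fin s) ≤ Fintype.card C := by
    simpa using Nat.div_mul_le_self _ _
  obtain ⟨f⟩ := Function.Embedding.nonempty_of_card_le hM
  refine ⟨Fintype.card C / s, fun x => Sum.elim (fun y => τ (y.1, y.2, x.2))
    (fun l => (f (l, x.2) : V)) x.1, ?_, fun b p a => rfl, ?_⟩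
  · rintro ⟨x | x, a⟩ ⟨y | y, b⟩ h
    · have := hτ h
      simp only [Prod.mk.injEq] at this
      simp [Prod.ext_iff, this.1, this.2.1, this.2.2]
    · exact absurd ⟨_, h⟩ (f (y, b)).2
    · exact absurd ⟨_, h.symm⟩ (f (x, a)).2
    · have := f.injective (Subtype.ext h)
      simp only [Prod.mk.injEq] at this
      simp [this.1, this.2]
  · have h1 := Nat.div_add_mod (Fintype.card C) s
    have h2 := Nat.mod_lt (Fintype.card C) hs
    simp only [Fintype.card_sum, Fintype.card_prod, Fintype.card_fin]
    rw [hcard, add_mul, mul_comm (Fintype.card C / s) s]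
    omega

lemma exists_refined_tiling {V β β' : Type} [Fintype β] [Fintype β']
    {s t L M : ℕ} (R : V → V → V → Prop) (π : ((β × Fin 3) ⊕ Fin M) × Fin s → V)
    (hπ : Function.Injective π)
    (hR : ∀ b i j k, R (π (Sum.inl (b, 0), i)) (π (Sum.inl (b, 1), j)) (π (Sum.inl (b, 2), k)))
    (e : β' → Fin 3 → (β × Fin 3) ⊕ Fin M) (σ : β' → Fin 3 → Fin t → Fin s)
    (h1 : ∀ b i j k, R (π (e b 0, σ b 0 i)) (π (e b 1, σ b 1 j)) (π (e b 2, σ b 2 k)))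
    (h2 : Function.Injective (fun y : β' × Fin 3 × Fin t => (e y.1 y.2.1, σ y.1 y.2.1 y.2.2)))
    (hL : ∀ i, t * num (fun y : β' × Fin 3 => e y.1 y.2 = i) + L * t ≤ s) :
    ∃ τ : (β' ⊕ (β × Fin L)) × Fin 3 × Fin t → V, IsTiling R t τ := by
  classical
  have hf : ∀ i, ∃ f : Fin L × Fin t → Fin s, Function.Injective f ∧
      ∀ x, ¬ ∃ b, True ∧ ∃ p a, e b p = i ∧ σ b p a = f x := by
    intro i
    have k1 := num_used_le e σ i (fun _ => True)
    have k2 := num_add_num_not (fun x : Fin s => ∃ b, True ∧ ∃ p a, e b p = i ∧ σ b p a = x)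
    rw [Fintype.card_fin] at k2
    have k3 := hL i
    have k4 : L * t ≤ num (fun x : Fin s => ¬ ∃ b, True ∧ ∃ p a, e b p = i ∧ σ b p a = x) := by
      omega
    unfold num at k4
    rw [← Fintype.card_subtype] at k4
    obtain ⟨f⟩ := Function.Embedding.nonempty_of_card_le (α := Fin L × Fin t)
      (β := {x : Fin s // ¬ ∃ b, True ∧ ∃ p a, e b p = i ∧ σ b p a = x})
      (by rw [Fintype.card_prod, Fintype.card_fin, Fintype.card_fin]; exact k4)
    exact ⟨fun x => f x, fun x y h => f.injective (Subtype.ext h), fun x => (f x).2⟩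
  choose f hf1 hf2 using hf
  refine ⟨fun y => π (Sum.elim (fun b => (e b y.2.1, σ b y.2.1 y.2.2))
    (fun z => (Sum.inl (z.1, y.2.1), f (Sum.inl (z.1, y.2.1)) (z.2, y.2.2))) y.1), ?_, ?_⟩
  · rintro ⟨b | ⟨b, l⟩, p, a⟩ ⟨b' | ⟨b', l'⟩, p', a'⟩ h
    · have := h2 (a₁ := (b, p, a)) (a₂ := (b', p', a')) (hπ h)
      simp only [Prod.mk.injEq] at this
      simp [this.1, this.2.1, this.2.2]
    · have := hπ h
      simp only [Sum.elim_inl, Sum.elim_inr, Prod.mk.injEq] at this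
      exact absurd ⟨b, trivial, p, a, this⟩ (hf2 _ _)
    · have := hπ h
      simp only [Sum.elim_inl, Sum.elim_inr, Prod.mk.injEq] at this
      exact absurd ⟨b', trivial, p', a', this.1.symm, this.2.symm⟩ (hf2 _ _)
    · have := hπ h
      simp only [Sum.elim_inr, Prod.mk.injEq, Sum.inl.injEq] at this
      obtain ⟨⟨rfl, rfl⟩, h3⟩ := this
      have := hf1 _ h3
      simp only [Prod.mk.injEq] at this
      simp [this.1, this.2]
  · rintro (b | ⟨b, l⟩) i j k
    · exact h1 b i j k
    · exact hR b _ _ _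

/-- Large dense `3`-graphs contain tilings by complete tripartite graphs with parts of any given
size which cover all but a proportion `c` of the vertices. -/
def TilesUpTo (γ c : ℝ) : Prop :=
  ∀ s : ℕ, 1 ≤ s → ∃ n₀ : ℕ, ∀ (V : Type) [Fintype V], n₀ ≤ Fintype.card V →
    ∀ R : V → V → V → Prop,
      (∀ x, (5 / 9 + γ) * (Fintype.card V : ℝ) ^ 2 ≤ num (fun p : V × V => R x p.1 p.2)) →
      ∃ (β : Type) (_ : Fintype β) (τ : β × Fin 3 × Fin s → V), IsTiling R s τ ∧
        (1 - c) * Fintype.card V ≤ 3 * s * Fintype.card β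

lemma TilesUpTo.mono {γ c c' : ℝ} (h : TilesUpTo γ c) (hc : c ≤ c') : TilesUpTo γ c' := by
  intro s hs
  obtain ⟨n₀, hn₀⟩ := h s hs
  refine ⟨n₀, fun V _ hV R hR => ?_⟩
  obtain ⟨β, hβ, τ, h1, h2⟩ := hn₀ V hV R hR
  exact ⟨β, hβ, τ, h1, le_trans (by gcongr) h2⟩

lemma tilesUpTo_one (γ : ℝ) : TilesUpTo γ 1 := by
  intro s _
  refine ⟨0, fun V _ _ R _ => ⟨Empty, inferInstance, fun x => x.1.elim, ?_, by simp⟩⟩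
  exact ⟨fun x => x.1.elim, fun b => b.elim⟩

/-- A fractional matching of the reduced graph can be rounded. -/
lemma exists_rounding {ι κ : Type} [Fintype ι] [DecidableEq ι] [Fintype κ] (e : κ → Fin 3 → ι)
    (x : κ → ℝ) (hκ : Fintype.card κ ≤ Fintype.card ι + 1) (hx0 : ∀ a, 0 ≤ x a)
    (hx : ∀ i, ∑ a, x a * ∑ p : Fin 3, (if e a p = i then (1 : ℝ) else 0) = 1)
    (w : ℝ) (hw : 0 ≤ w) (t : ℕ) (ht : 1 ≤ t) :
    ∃ (β : Type) (_ : Fintype β) (f : β → κ),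
      (∀ i, (t : ℝ) * num (fun y : β × Fin 3 => e (f y.1) y.2 = i) ≤ w) ∧
      w * Fintype.card ι - 3 * t * (Fintype.card ι + 1) ≤ 3 * t * Fintype.card β := by
  have ht0 : (0 : ℝ) < t := by exact_mod_cast ht
  let N : κ → ℕ := fun a => ⌊w * x a / t⌋₊
  have hN1 : ∀ a, (t : ℝ) * N a ≤ w * x a := by
    intro a
    have := Nat.floor_le (div_nonneg (mul_nonneg hw (hx0 a)) ht0.le)
    rw [le_div_iff₀ ht0] at this
    linarith
  have hN2 : ∀ a, w * x a ≤ t * N a + t := by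
    intro a
    have := (Nat.lt_floor_add_one (w * x a / t)).le
    rw [div_le_iff₀ ht0] at this
    linarith
  refine ⟨Σ a, Fin (N a), inferInstance, fun y => y.1, ?_, ?_⟩
  · intro i
    rw [num_prod (fun (b : Σ a, Fin (N a)) (p : Fin 3) => e b.1 p = i), Fintype.sum_sigma]
    have h1 : ∀ a, ((∑ b : Fin (N a), num (fun p : Fin 3 => e a p = i) : ℕ) : ℝ) =
        N a * ∑ p : Fin 3, (if e a p = i then (1 : ℝ) else 0) := by
      intro a
      simp only [Finset.sum_const, Finset.card_univ, Fintype.card_fin, smul_eq_mul]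
      rw [num_eq_sum]
      push_cast
      congr 1
    rw [Nat.cast_sum, Finset.sum_congr rfl (fun a _ => h1 a), Finset.mul_sum]
    calc _ ≤ ∑ a, w * x a * ∑ p : Fin 3, (if e a p = i then (1 : ℝ) else 0) := by
          refine Finset.sum_le_sum (fun a _ => ?_)
          rw [← mul_assoc]
          refine mul_le_mul_of_nonneg_right (hN1 a) (Finset.sum_nonneg (fun p _ => ?_))
          split_ifs <;> simp
      _ = w := by
          simp_rw [mul_assoc]
          rw [← Finset.mul_sum, hx i, mul_one]
  · have h2 : 3 * ∑ a, x a = Fintype.card ι := by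
      have : ∑ i, ∑ a, x a * ∑ p : Fin 3, (if e a p = i then (1 : ℝ) else 0) =
          Fintype.card ι := by
        simp_rw [hx]
        simp
      rw [← this, Finset.sum_comm, Finset.mul_sum]
      refine Finset.sum_congr rfl (fun a _ => ?_)
      rw [← Finset.mul_sum, Finset.sum_comm]
      simp [mul_comm]
    have h3 : ∑ a, w * x a ≤ ∑ a, ((t : ℝ) * N a + t) := Finset.sum_le_sum (fun a _ => hN2 a)
    rw [← Finset.mul_sum, Finset.sum_add_distrib, ← Finset.mul_sum] at h3
    simp only [Finset.sum_const, Finset.card_univ, nsmul_eq_mul] at h3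
    have h4 : (Fintype.card (Σ a, Fin (N a)) : ℝ) = ∑ a, (N a : ℝ) := by simp
    rw [h4, ← h2]
    have h5 : (Fintype.card κ : ℝ) ≤ Fintype.card ι + 1 := by exact_mod_cast hκ
    have h6 := mul_le_mul_of_nonneg_right h5 ht0.le
    rw [← h2] at h6
    nlinarith

lemma injective_of_ne {ι : Type*} {e : Fin 3 → ι} (h : e 0 ≠ e 1 ∧ e 0 ≠ e 2 ∧ e 1 ≠ e 2) :
    Function.Injective e := by
  obtain ⟨h1, h2, h3⟩ := h
  intro p q hpq
  match p, q with
  | 0, 0 => rfl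
  | 0, 1 => exact absurd hpq h1
  | 0, 2 => exact absurd hpq h2
  | 1, 0 => exact absurd hpq.symm h1
  | 1, 1 => rfl
  | 1, 2 => exact absurd hpq h3
  | 2, 0 => exact absurd hpq.symm h2
  | 2, 1 => exact absurd hpq.symm h3
  | 2, 2 => rfl

lemma TilesUpTo.step {γ c δ : ℝ} (hγ : 0 < γ) (hγ1 : γ ≤ 1) (hδ : 0 < δ) (h : TilesUpTo γ c) :
    TilesUpTo γ ((1 - γ / 24) * c + δ) := by
  intro t ht
  obtain ⟨s₀, hs₀⟩ := exists_complete_tripartite t (γ / 4 / 2) (by positivity)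
  set s := max s₀ (max 1 ⌈8 * t / δ⌉₊) with hs
  have hs1 : 1 ≤ s := by simp [hs]
  have hs2 : s₀ ≤ s := by simp [hs]
  have hs3 : 8 * (t : ℝ) ≤ δ * s := by
    have h1 : ⌈8 * t / δ⌉₊ ≤ s := (le_max_right _ _).trans (le_max_right _ _)
    have : 8 * t / δ ≤ (s : ℝ) := (Nat.le_ceil _).trans (by exact_mod_cast h1)
    rw [div_le_iff₀ hδ] at this
    linarith
  clear_value s
  obtain ⟨n₁, hn₁⟩ := h s hs1
  refine ⟨max n₁ (max ⌈s * (16 / γ + 2)⌉₊ ⌈2 * (s + 3 * t) / δ⌉₊), fun V _ hV R hR => ?_⟩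
  obtain ⟨β, hβ, τ, hτ, hcount⟩ := hn₁ V ((le_max_left _ _).trans hV) R hR
  have hV1 : s * (16 / γ + 2) ≤ (Fintype.card V : ℝ) := (Nat.le_ceil _).trans (by
    exact_mod_cast ((le_max_left _ _).trans (le_max_right _ _)).trans hV)
  have hV2 : 2 * (s + 3 * t) ≤ δ * (Fintype.card V : ℝ) := by
    have : 2 * (s + 3 * t) / δ ≤ (Fintype.card V : ℝ) := (Nat.le_ceil _).trans (by
      exact_mod_cast ((le_max_right _ _).trans (le_max_right _ _)).trans hV)
    rw [div_le_iff₀ hδ] at this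
    linarith
  obtain ⟨M, π, hπ, hπτ, hVr⟩ := exists_extend_partition hs1 τ hτ.1
  classical
  set r := Fintype.card ((β × Fin 3) ⊕ Fin M) with hr
  set n := Fintype.card V with hn
  have hsR : (0 : ℝ) < s := by exact_mod_cast hs1
  have hVr' : (n : ℝ) ≤ r * s + s := by exact_mod_cast hVr
  have hrs : (r : ℝ) * s ≤ n := by
    have := Fintype.card_le_of_injective π hπ
    rw [Fintype.card_prod, Fintype.card_fin] at this
    exact_mod_cast this
  have hr16 : 16 / γ + 1 ≤ (r : ℝ) := by
    have : (s : ℝ) * (16 / γ + 1) ≤ s * r := by nlinarith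
    exact le_of_mul_le_mul_left this hsR
  have hγ16 : 0 < 16 / γ := by positivity
  have hr1 : (1 : ℝ) ≤ r := by linarith
  have hrγ : 16 ≤ γ * r := by
    have : 16 / γ ≤ (r : ℝ) := by linarith
    rw [div_le_iff₀ hγ] at this
    linarith
  have hne : Nonempty ((β × Fin 3) ⊕ Fin M) := by
    rw [← Fintype.card_pos_iff]
    exact_mod_cast (by linarith : (0 : ℝ) < r)
  have hdeg := reduced_degree hs1 R π hπ hVr (5 / 9 + γ) (γ / 4) (by positivity) (by positivity) hR
  obtain ⟨κ, hκ, e, x, hκc, he, hx0, hx⟩ := exists_fractional_matching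
    (fun i j k : (β × Fin 3) ⊕ Fin M => (i ≠ j ∧ i ≠ k ∧ j ≠ k) ∧
        γ / 4 * (s : ℝ) ^ 3 ≤ num (fun p : Fin s × Fin s × Fin s =>
          R (π (i, p.1)) (π (j, p.2.1)) (π (k, p.2.2)))) (by
    intro i
    have h1 := hdeg i
    simp only [← hr] at h1 ⊢
    have h2 : 16 * (r : ℝ) ≤ γ * r * r := by gcongr
    nlinarith)
  have hηs : 0 ≤ γ / 24 * s := by positivity
  obtain ⟨β', hβ', f, hload, hcard⟩ := exists_rounding e x hκc hx0 hx (γ / 24 * s) hηs t ht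
  obtain ⟨σ, hσ1, hσ2⟩ := exists_packing (t := t) (s := s)
    (fun i j k a b c => R (π (i, a)) (π (j, b)) (π (k, c))) (γ / 4) (γ / 24) (by linarith)
    (hs₀ s hs2) (fun b => e (f b)) 
    (fun b => injective_of_ne (he (f b)).1) (fun b => (he (f b)).2) hload
  have ht0 : (0 : ℝ) < t := by exact_mod_cast ht
  have h24 : 0 ≤ (1 - γ / 24) * s / t := by
    have : 0 ≤ 1 - γ / 24 := by linarith
    positivity
  have hL1 := Nat.floor_le h24
  have hL2 := (Nat.lt_floor_add_one ((1 - γ / 24) * s / t)).le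
  rw [le_div_iff₀ ht0] at hL1
  rw [div_le_iff₀ ht0] at hL2
  set L := ⌊(1 - γ / 24) * s / t⌋₊ with hL
  obtain ⟨τ', hτ'⟩ := exists_refined_tiling (L := L) R π hπ (by
      intro b i j k
      rw [hπτ, hπτ, hπτ]
      exact hτ.2 b i j k) (fun b => e (f b)) σ hσ1 hσ2 (by
      intro i
      have := hload i
      have h3 : ((t * num (fun y : β' × Fin 3 => e (f y.1) y.2 = i) + L * t : ℕ) : ℝ) ≤ s := by
        push_cast
        linarith
      exact_mod_cast h3)
  refine ⟨_, inferInstance, τ', hτ', ?_⟩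
  have hrN : (3 : ℝ) * Fintype.card β ≤ r := by
    have : 3 * Fintype.card β ≤ r := by
      rw [hr]
      simp only [Fintype.card_sum, Fintype.card_prod, Fintype.card_fin]
      omega
    exact_mod_cast this
  rw [Fintype.card_sum, Fintype.card_prod, Fintype.card_fin]
  push_cast
  set N : ℝ := (Fintype.card β : ℝ) with hN
  have hN0 : 0 ≤ N := by positivity
  have q1 : 3 * N * ((1 - γ / 24) * s) ≤ 3 * N * ((L + 1) * t) := by gcongr
  have q2 : (1 - γ / 24) * ((1 - c) * n) ≤ (1 - γ / 24) * (3 * s * N) :=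
    mul_le_mul_of_nonneg_left hcount (by linarith)
  have q3 : γ / 24 * n ≤ γ / 24 * (r * s + s) := by gcongr
  have q4 : t * (3 * N) ≤ t * r := by gcongr
  have q5 : r * (8 * t) ≤ r * (δ * s) := by gcongr
  have q6 : δ * (r * s) ≤ δ * n := by gcongr
  have q7 : γ / 24 * s ≤ 1 * s := by gcongr; linarith
  linarith

lemma tilesUpTo {γ ε : ℝ} (hγ : 0 < γ) (hγ1 : γ ≤ 1) (hε : 0 < ε) : TilesUpTo γ ε := by
  have h : ∀ k : ℕ, TilesUpTo γ (ε / 2 + (1 - γ / 24) ^ k) := by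
    intro k
    induction k with
    | zero => exact (tilesUpTo_one γ).mono (by simp; linarith)
    | succ k ih =>
      refine (ih.step hγ hγ1 (δ := γ / 24 * (ε / 2)) (by positivity)).mono (le_of_eq ?_)
      ring
  obtain ⟨k, hk⟩ := exists_pow_lt_of_lt_one (half_pos hε) (by linarith : 1 - γ / 24 < 1)
  exact (h k).mono (by linarith)

end AlmostTilingIteration

section Linking

variable {V : Type} [Fintype V]

/-- `x` and `y` have many common link pairs of large codegree. -/
def Near (γ : ℝ) (R : V → V → V → Prop) (x y : V) : Prop :=
  γ ^ 2 / 2 * (Fintype.card V : ℝ) ^ 2 ≤ num (fun p : V × V => (R x p.1 p.2 ∧ R y p.1 p.2) ∧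
    γ ^ 3 / 8 * Fintype.card V ≤ (num (fun z => R z p.1 p.2) : ℝ))

lemma sum_num_link (R : V → V → V → Prop) (P : V × V → Prop) :
    ∑ y, num (fun p : V × V => R y p.1 p.2 ∧ P p) =
      ∑ p : V × V, num (fun y => R y p.1 p.2 ∧ P p) := by
  rw [← num_prod (fun y (p : V × V) => R y p.1 p.2 ∧ P p),
    ← num_prod_right (fun y (p : V × V) => R y p.1 p.2 ∧ P p)]

lemma num_link_good {γ : ℝ} (hγ : 0 < γ) {R : V → V → V → Prop}
    (hR : ∀ x, (1 / 2 + γ) * (Fintype.card V : ℝ) ^ 2 ≤ num (fun p : V × V => R x p.1 p.2))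
    (x : V) :
    γ * (Fintype.card V : ℝ) ^ 2 ≤ num (fun p : V × V => R x p.1 p.2 ∧
      γ * Fintype.card V ≤ (num (fun z => R z p.1 p.2) : ℝ)) := by
  have hn : (0 : ℝ) < Fintype.card V := by exact_mod_cast Fintype.card_pos_iff.mpr ⟨x⟩
  set n : ℝ := (Fintype.card V : ℝ) with hnV
  have h1 : n * ((1 / 2 + γ) * n ^ 2) ≤ ∑ p : V × V, (num (fun y => R y p.1 p.2) : ℝ) := by
    have h2 := sum_num_link R (fun _ => True)
    simp only [and_true] at h2
    rw [← Nat.cast_sum, ← h2, Nat.cast_sum]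
    calc n * ((1 / 2 + γ) * n ^ 2) = ∑ _y : V, (1 / 2 + γ) * n ^ 2 := by simp [hnV]
      _ ≤ _ := Finset.sum_le_sum (fun y _ => hR y)
  have h2 := sum_le_num_mul_add (fun p : V × V => (num (fun y => R y p.1 p.2) : ℝ)) n (γ * n)
    (fun p => Nat.cast_le.mpr (num_le_card _)) (by positivity)
  rw [Fintype.card_prod, Nat.cast_mul, ← hnV] at h2
  have h3 : 1 / 2 * n ^ 2 ≤ num (fun p : V × V => γ * n ≤ (num (fun y => R y p.1 p.2) : ℝ)) := by
    refine le_of_mul_le_mul_right ?_ hn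
    linarith
  have h4 := num_add_num_le (fun p : V × V => R x p.1 p.2)
    (fun p : V × V => γ * n ≤ (num (fun y => R y p.1 p.2) : ℝ))
  rw [← Nat.cast_le (α := ℝ), Fintype.card_prod] at h4
  push_cast at h4
  rw [← hnV] at h4
  have h5 := hR x
  nlinarith

lemma exists_typical {γ : ℝ} (hγ : 0 < γ) (hγ1 : γ ≤ 1) {R : V → V → V → Prop}
    (hR : ∀ x, (1 / 2 + γ) * (Fintype.card V : ℝ) ^ 2 ≤ num (fun p : V × V => R x p.1 p.2)) :
    ∃ Ty : V → Prop,
      (∀ x, γ ^ 2 / 4 * Fintype.card V ≤ (num (fun y => Near γ R x y ∧ Ty y) : ℝ)) ∧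
      ∀ y y', Ty y → Ty y' → Near γ R y y' := by
  set n : ℝ := (Fintype.card V : ℝ) with hnV
  let G : V × V → Prop := fun p => γ ^ 3 / 8 * n ≤ (num (fun z => R z p.1 p.2) : ℝ)
  refine ⟨fun y => ¬ γ / 2 * n ^ 2 ≤ (num (fun p : V × V => R y p.1 p.2 ∧ ¬ G p) : ℝ), ?_, ?_⟩
  · intro x
    have hn : 0 < n := by
      rw [hnV]
      exact_mod_cast Fintype.card_pos_iff.mpr ⟨x⟩
    have hγ2 : γ ^ 3 / 8 * n ≤ γ * n := by
      have : γ ^ 3 ≤ γ := by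
        calc γ ^ 3 ≤ γ ^ 1 := pow_le_pow_of_le_one hγ.le hγ1 (by norm_num)
          _ = γ := pow_one γ
      have : γ ^ 3 / 8 ≤ γ := by linarith
      gcongr
    have h1 : γ * n ^ 2 * (γ * n) ≤
        ∑ y, (num (fun p : V × V => R y p.1 p.2 ∧ (R x p.1 p.2 ∧
          γ * n ≤ (num (fun z => R z p.1 p.2) : ℝ))) : ℝ) := by
      rw [← Nat.cast_sum, sum_num_link, Nat.cast_sum]
      classical
      calc γ * n ^ 2 * (γ * n) ≤ (num (fun p : V × V => R x p.1 p.2 ∧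
          γ * n ≤ (num (fun z => R z p.1 p.2) : ℝ)) : ℝ) * (γ * n) := by
            gcongr
            exact num_link_good hγ hR x
        _ ≤ _ := by
            rw [num_eq_sum]
            push_cast
            rw [Finset.sum_mul]
            refine Finset.sum_le_sum (fun p _ => ?_)
            split_ifs with h
            · simp [h.1, h.2]
            · simp
    have h2 := sum_le_num_mul_add (fun y => (num (fun p : V × V => R y p.1 p.2 ∧ (R x p.1 p.2 ∧
          γ * n ≤ (num (fun z => R z p.1 p.2) : ℝ))) : ℝ)) (n ^ 2) (γ ^ 2 / 2 * n ^ 2)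
      (fun y => by
        have := num_le_card (fun p : V × V => R y p.1 p.2 ∧ (R x p.1 p.2 ∧
          γ * n ≤ (num (fun z => R z p.1 p.2) : ℝ)))
        rw [Fintype.card_prod] at this
        rw [hnV, pow_two]
        exact_mod_cast this) (by positivity)
    rw [← hnV] at h2
    have h3 : γ ^ 2 / 2 * n ≤ num (fun y => γ ^ 2 / 2 * n ^ 2 ≤
        (num (fun p : V × V => R y p.1 p.2 ∧ (R x p.1 p.2 ∧
          γ * n ≤ (num (fun z => R z p.1 p.2) : ℝ))) : ℝ)) := by
      refine le_of_mul_le_mul_right ?_ (by positivity : 0 < n ^ 2)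
      linarith
    have h4 : num (fun y => γ ^ 2 / 2 * n ^ 2 ≤
        (num (fun p : V × V => R y p.1 p.2 ∧ (R x p.1 p.2 ∧
          γ * n ≤ (num (fun z => R z p.1 p.2) : ℝ))) : ℝ)) ≤ num (fun y => Near γ R x y) := by
      refine num_mono (fun y hy => hy.trans ?_)
      refine Nat.cast_le.mpr (num_mono ?_)
      exact fun p hp => ⟨⟨hp.2.1, hp.1⟩, hγ2.trans hp.2.2⟩
    have h5 := mul_num_le_sum (fun y => (num (fun p : V × V => R y p.1 p.2 ∧ ¬ G p) : ℝ))
      (fun y => by positivity) (γ / 2 * n ^ 2)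
    have h6 : ∑ y, (num (fun p : V × V => R y p.1 p.2 ∧ ¬ G p) : ℝ) ≤
        n ^ 2 * (γ ^ 3 / 8 * n) := by
      rw [← Nat.cast_sum, sum_num_link, Nat.cast_sum]
      calc _ ≤ ∑ _p : V × V, γ ^ 3 / 8 * n := by
            refine Finset.sum_le_sum (fun p _ => ?_)
            by_cases h : G p
            · have : num (fun y => R y p.1 p.2 ∧ ¬ G p) = 0 := by simp [num, h]
              rw [this, Nat.cast_zero]
              positivity
            · simp only [h, not_false_eq_true, and_true]
              exact (not_le.mp h).le
        _ = _ := by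
            simp [hnV, pow_two]
    have h7 : (num (fun y => γ / 2 * n ^ 2 ≤
        (num (fun p : V × V => R y p.1 p.2 ∧ ¬ G p) : ℝ)) : ℝ) ≤ γ ^ 2 / 4 * n := by
      refine le_of_mul_le_mul_left ?_ (by positivity : 0 < γ / 2 * n ^ 2)
      refine (h5.trans h6).trans (le_of_eq (by ring))
    have h8 := num_add_num_not (fun y => γ / 2 * n ^ 2 ≤
        (num (fun p : V × V => R y p.1 p.2 ∧ ¬ G p) : ℝ))
    have h9 := num_add_num_le (fun y => Near γ R x y) (fun y => ¬ γ / 2 * n ^ 2 ≤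
        (num (fun p : V × V => R y p.1 p.2 ∧ ¬ G p) : ℝ))
    rw [← h8] at h9
    have h10 : num (fun y => Near γ R x y) ≤ num (fun y => Near γ R x y ∧ ¬ γ / 2 * n ^ 2 ≤
        (num (fun p : V × V => R y p.1 p.2 ∧ ¬ G p) : ℝ)) + num (fun y => γ / 2 * n ^ 2 ≤
        (num (fun p : V × V => R y p.1 p.2 ∧ ¬ G p) : ℝ)) := by omega
    have h11 := h4.trans h10
    rw [← Nat.cast_le (α := ℝ)] at h11
    push_cast at h11
    linarith
  · intro y y' hy hy'
    have hstep : ∀ y, ¬ γ / 2 * n ^ 2 ≤ (num (fun p : V × V => R y p.1 p.2 ∧ ¬ G p) : ℝ) →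
        (1 / 2 + γ / 2) * n ^ 2 ≤ num (fun p : V × V => R y p.1 p.2 ∧ G p) := by
      intro y hy
      have h1 := num_or_le (fun p : V × V => R y p.1 p.2 ∧ G p)
        (fun p : V × V => R y p.1 p.2 ∧ ¬ G p)
      have h2 : num (fun p : V × V => R y p.1 p.2) ≤
          num (fun p : V × V => (R y p.1 p.2 ∧ G p) ∨ (R y p.1 p.2 ∧ ¬ G p)) :=
        num_mono (fun p hp => by by_cases h : G p <;> simp [hp, h])
      have h3 := h2.trans h1
      rw [← Nat.cast_le (α := ℝ)] at h3
      push_cast at h3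
      have h4 := hR y
      linarith [not_le.mp hy]
    have h1 := hstep y hy
    have h2 := hstep y' hy'
    have h3 := num_add_num_le (fun p : V × V => R y p.1 p.2 ∧ G p)
      (fun p : V × V => R y' p.1 p.2 ∧ G p)
    rw [← Nat.cast_le (α := ℝ), Fintype.card_prod] at h3
    push_cast at h3
    rw [← hnV] at h3
    have h4 : num (fun p : V × V => (R y p.1 p.2 ∧ G p) ∧ (R y' p.1 p.2 ∧ G p)) ≤
        num (fun p : V × V => (R y p.1 p.2 ∧ R y' p.1 p.2) ∧ G p) :=
      num_mono (fun p hp => ⟨⟨hp.1.1, hp.2.1⟩, hp.1.2⟩)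
    rw [← Nat.cast_le (α := ℝ)] at h4
    have h5 : γ ^ 2 / 2 * n ^ 2 ≤ γ * n ^ 2 := by
      have : γ ^ 2 ≤ γ := by nlinarith
      have : γ ^ 2 / 2 ≤ γ := by linarith
      gcongr
    refine h5.trans (le_trans ?_ h4)
    linarith

variable {m : ℕ}

/-- `s` maps the complete tripartite graph with parts of size `m` homomorphically to `R`. -/
def IsHom (R : V → V → V → Prop) (s : Fin 3 × Fin m → V) : Prop :=
  ∀ i j k, R (s (0, i)) (s (1, j)) (s (2, k))

variable [NeZero m]

/-- The vertices `x` and `y` are interchangeable as the root in a proportion `c` of the maps. -/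
def Linked (m : ℕ) [NeZero m] (c : ℝ) (R : V → V → V → Prop) (x y : V) : Prop :=
  c * (Fintype.card V : ℝ) ^ (3 * m) ≤ num (fun s : Fin 3 × Fin m → V =>
    IsHom R (Function.update s (0, 0) x) ∧ IsHom R (Function.update s (0, 0) y))

lemma isHom_update {V : Type} {R : V → V → V → Prop} {s : Fin 3 × Fin m → V} {x : V}
    (hx : ∀ j k, R x (s (1, j)) (s (2, k))) (hs : IsHom R s) :
    IsHom R (Function.update s (0, 0) x) := by
  intro i j k
  rw [Function.update_of_ne (a := ((1 : Fin 3), j)) (by simp),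
    Function.update_of_ne (a := ((2 : Fin 3), k)) (by simp)]
  by_cases hi : i = 0
  · subst hi
    rw [Function.update_self]
    exact hx j k
  · rw [Function.update_of_ne (by simpa using hi)]
    exact hs i j k

lemma Near.linked {γ : ℝ} (hγ : 0 < γ) {R : V → V → V → Prop} {x y : V} (h : Near γ R x y) :
    Linked m ((γ ^ 2 / 2 * (γ ^ 3 / 8)) ^ (m ^ 3)) R x y := by
  classical
  unfold Linked
  set n : ℝ := (Fintype.card V : ℝ) with hnV
  have h1 := blowup_three (fun z b c => R z b c ∧ R x b c ∧ R y b c) m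
    (γ ^ 2 / 2 * (γ ^ 3 / 8)) (by positivity) (by
      rw [num_prod (fun z (p : V × V) => R z p.1 p.2 ∧ R x p.1 p.2 ∧ R y p.1 p.2), sum_num_link]
      rw [← hnV]
      have h2 : γ ^ 2 / 2 * n ^ 2 * (γ ^ 3 / 8 * n) ≤ (num (fun p : V × V =>
          (R x p.1 p.2 ∧ R y p.1 p.2) ∧
            γ ^ 3 / 8 * n ≤ (num (fun z => R z p.1 p.2) : ℝ)) : ℝ) * (γ ^ 3 / 8 * n) := by
        gcongr
        exact h
      refine le_trans (le_of_eq (by ring)) (h2.trans ?_)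
      rw [num_eq_sum]
      push_cast
      rw [Finset.sum_mul]
      refine Finset.sum_le_sum (fun p _ => ?_)
      split_ifs with h
      · simpa [h.1] using h.2
      · simp)
  rw [← hnV] at h1
  have h2 : num (fun p : (Fin m → V) × (Fin m → V) × (Fin m → V) =>
        ∀ i j k, R (p.1 i) (p.2.1 j) (p.2.2 k) ∧ R x (p.2.1 j) (p.2.2 k) ∧
          R y (p.2.1 j) (p.2.2 k)) ≤ num (fun s : Fin 3 × Fin m → V =>
    IsHom R (Function.update s (0, 0) x) ∧ IsHom R (Function.update s (0, 0) y)) := by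
    refine num_le_of_injective (fun p w => if w.1 = 0 then p.1 w.2 else
      if w.1 = 1 then p.2.1 w.2 else p.2.2 w.2) ?_ ?_
    · rintro ⟨a, b, c⟩ ⟨a', b', c'⟩ hh
      simp only [Prod.mk.injEq]
      refine ⟨funext fun i => ?_, funext fun i => ?_, funext fun i => ?_⟩
      · simpa using congrFun hh (0, i)
      · simpa using congrFun hh (1, i)
      · simpa using congrFun hh (2, i)
    · rintro ⟨a, b, c⟩ hh
      exact ⟨isHom_update (fun j k => (hh 0 j k).2.1) (fun i j k => (hh i j k).1),
        isHom_update (fun j k => (hh 0 j k).2.2) (fun i j k => (hh i j k).1)⟩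
  refine le_trans (le_of_eq ?_) (h1.trans (by exact_mod_cast h2))
  ring

end Linking

section Absorbers

variable {V : Type} {m : ℕ} [NeZero m]

/-- Three maps of the complete tripartite graph linking `x` to the root of the last one: each of
them stays a homomorphism when its root is replaced by `x` or the root of the previous one. -/
def IsLinkChain (R : V → V → V → Prop) (x : V) (σ : Fin 3 × (Fin 3 × Fin m) → V) : Prop :=
  (∀ i, IsHom R (fun w => σ (i, w))) ∧
  IsHom R (Function.update (fun w => σ (0, w)) (0, 0) x) ∧
  IsHom R (Function.update (fun w => σ (1, w)) (0, 0) (σ (0, (0, 0)))) ∧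
  IsHom R (Function.update (fun w => σ (2, w)) (0, 0) (σ (1, (0, 0))))

/-- `ω` consists of chains linking the vertices `u w` to the vertices of a further copy. -/
def IsAbsorber (R : V → V → V → Prop) (u : Fin 3 × Fin m → V)
    (ω : (Fin 3 × Fin m) × (Fin 3 × (Fin 3 × Fin m)) → V) : Prop :=
  (∀ w, IsLinkChain R (u w) (fun q => ω (w, q))) ∧ IsHom R (fun w => ω (w, (2, (0, 0))))

lemma eq_of_update_eq {ι : Type*} [DecidableEq ι] {s s' : ι → V} {r : ι} {y y' : V}
    (h : Function.update s r y = Function.update s' r y') (hr : s r = s' r) :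
    s = s' ∧ y = y' := by
  constructor
  · funext w
    by_cases hw : w = r
    · rw [hw, hr]
    · simpa [hw] using congrFun h w
  · simpa using congrFun h r

variable [Fintype V]

lemma num_chain {R : V → V → V → Prop} {c c₁ : ℝ} (hc : 0 ≤ c) (hc₁ : 0 ≤ c₁) {Ty : V → Prop}
    (h1 : ∀ x, c₁ * Fintype.card V ≤ (num (fun y => Linked m c R x y ∧ Ty y) : ℝ))
    (h2 : ∀ y y', Ty y → Ty y' → Linked m c R y y') (h3 : ∀ x y, Linked m c R x y →
      Linked m c R y x) (x z : V) :
    c₁ ^ 2 * c ^ 3 * (Fintype.card V : ℝ) ^ (3 * (3 * m)) ≤ Fintype.card V *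
      (num (fun σ : Fin 3 × (Fin 3 × Fin m) → V => IsLinkChain R x σ ∧ σ (2, (0, 0)) = z) : ℝ) := by
  classical
  have hn : (0 : ℝ) < (Fintype.card V : ℝ) := by exact_mod_cast Fintype.card_pos_iff.mpr ⟨x⟩
  let H : (Fin 3 × Fin m → V) → V → V → Prop := fun s x y =>
    IsHom R (Function.update s (0, 0) x) ∧ IsHom R (Function.update s (0, 0) y)
  let P : V × V → Prop := fun y => (Linked m c R x y.1 ∧ Ty y.1) ∧ (Linked m c R z y.2 ∧ Ty y.2)
  have k1 : num (fun q : (V × V) × (Fin 3 × Fin m → V) × (Fin 3 × Fin m → V) ×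
        (Fin 3 × Fin m → V) =>
        H q.2.1 x q.1.1 ∧ H q.2.2.1 q.1.1 q.1.2 ∧ H q.2.2.2 q.1.2 z) ≤
      num (fun q : (Fin 3 × (Fin 3 × Fin m) → V) × (V × V × V) =>
        (IsLinkChain R x q.1 ∧ q.1 (2, (0, 0)) = z) ∧ True) := by
    refine num_le_of_injective (fun q => (fun p =>
      Function.update (![q.2.1, q.2.2.1, q.2.2.2] p.1) (0, 0) (![q.1.1, q.1.2, z] p.1) p.2,
      (q.2.1 (0, 0), q.2.2.1 (0, 0), q.2.2.2 (0, 0)))) ?_ ?_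
    · rintro ⟨⟨y₁, y₂⟩, s₁, s₂, s₃⟩ ⟨⟨y₁', y₂'⟩, s₁', s₂', s₃'⟩ h
      simp only [Prod.mk.injEq] at h
      obtain ⟨h, e1, e2, e3⟩ := h
      have g : ∀ i w, Function.update (![s₁, s₂, s₃] i) (0, 0) (![y₁, y₂, z] i) w =
          Function.update (![s₁', s₂', s₃'] i) (0, 0) (![y₁', y₂', z] i) w :=
        fun i w => congrFun h (i, w)
      obtain ⟨r1, r2⟩ := eq_of_update_eq (funext (g 0)) e1
      obtain ⟨r3, r4⟩ := eq_of_update_eq (funext (g 1)) e2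
      obtain ⟨r5, -⟩ := eq_of_update_eq (funext (g 2)) e3
      simp only [Matrix.cons_val] at r1 r2 r3 r4 r5
      rw [r1, r2, r3, r4, r5]
    · rintro ⟨⟨y₁, y₂⟩, s₁, s₂, s₃⟩ ⟨⟨a1, a2⟩, ⟨b1, b2⟩, c1, c2⟩
      refine ⟨⟨⟨?_, ?_, ?_, ?_⟩, ?_⟩, trivial⟩
      · intro i
        fin_cases i
        · exact a2
        · exact b2
        · exact c2
      · simpa using a1
      · simpa using b1
      · simpa using c1
      · simp
  rw [num_and (fun q : Fin 3 × (Fin 3 × Fin m) → V => IsLinkChain R x q ∧ q (2, (0, 0)) = z)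
    (fun _ : V × V × V => True),
    num_prod (fun (y : V × V) (s : (Fin 3 × Fin m → V) × (Fin 3 × Fin m → V) ×
        (Fin 3 × Fin m → V)) => H s.1 x y.1 ∧ H s.2.1 y.1 y.2 ∧ H s.2.2 y.2 z)] at k1
  have k2 : num (fun _ : V × V × V => True) = Fintype.card V ^ 3 := by
    simp [num]
    ring
  rw [k2] at k1
  have k3 : (num P : ℝ) * (c * (Fintype.card V : ℝ) ^ (3 * m)) ^ 3 ≤
      ∑ y : V × V, (num (fun s : (Fin 3 × Fin m → V) × (Fin 3 × Fin m → V) ×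
        (Fin 3 × Fin m → V) => H s.1 x y.1 ∧ H s.2.1 y.1 y.2 ∧ H s.2.2 y.2 z) : ℝ) := by
    rw [num_eq_sum]
    push_cast
    rw [Finset.sum_mul]
    refine Finset.sum_le_sum (fun y _ => ?_)
    split_ifs with hy
    · rw [num_and (fun s => H s x y.1)
        (fun s : (Fin 3 × Fin m → V) × (Fin 3 × Fin m → V) => H s.1 y.1 y.2 ∧ H s.2 y.2 z),
        num_and (fun s => H s y.1 y.2) (fun s => H s y.2 z)]
      push_cast
      have l1 : Linked m c R x y.1 := hy.1.1
      have l2 : Linked m c R y.1 y.2 := h2 _ _ hy.1.2 hy.2.2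
      have l3 : Linked m c R y.2 z := h3 _ _ hy.2.1
      unfold Linked at l1 l2 l3
      calc 1 * (c * (Fintype.card V : ℝ) ^ (3 * m)) ^ 3 =
          (c * (Fintype.card V : ℝ) ^ (3 * m)) * ((c * (Fintype.card V : ℝ) ^ (3 * m)) *
            (c * (Fintype.card V : ℝ) ^ (3 * m))) := by ring
        _ ≤ _ := by gcongr
    · simp
  have k4 : (c₁ * Fintype.card V) * (c₁ * Fintype.card V) ≤ (num P : ℝ) := by
    have : num P = num (fun y => Linked m c R x y ∧ Ty y) *
        num (fun y => Linked m c R z y ∧ Ty y) :=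
      num_and (fun y => Linked m c R x y ∧ Ty y) (fun y => Linked m c R z y ∧ Ty y)
    rw [this]
    push_cast
    gcongr
    · exact h1 x
    · exact h1 z
  rw [← Nat.cast_le (α := ℝ)] at k1
  push_cast at k1
  have k5 := (mul_le_mul_of_nonneg_right k4
    (by positivity : 0 ≤ (c * (Fintype.card V : ℝ) ^ (3 * m)) ^ 3)).trans (k3.trans k1)
  refine le_of_mul_le_mul_right ?_ (by positivity : 0 < (Fintype.card V : ℝ) ^ 2)
  refine le_trans (le_of_eq ?_) (k5.trans (le_of_eq ?_))
  · ring
  · ring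

lemma num_hom {R : V → V → V → Prop} {c : ℝ} (hV : 0 < Fintype.card V)
    (h : ∀ x, ∃ y, Linked m c R x y) :
    c * (Fintype.card V : ℝ) ^ (3 * m) ≤ num (fun s : Fin 3 × Fin m → V => IsHom R s) := by
  have k1 : num (fun q : V × (Fin 3 × Fin m → V) => IsHom R (Function.update q.2 (0, 0) q.1)) ≤
      num (fun q : V × (Fin 3 × Fin m → V) => True ∧ IsHom R q.2) := by
    refine num_le_of_injective (fun q => (q.2 (0, 0), Function.update q.2 (0, 0) q.1)) ?_ ?_
    · rintro ⟨y, s⟩ ⟨y', s'⟩ hh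
      simp only [Prod.mk.injEq] at hh
      obtain ⟨r1, r2⟩ := eq_of_update_eq hh.2 hh.1
      rw [r1, r2]
    · rintro ⟨y, s⟩ hh
      exact ⟨trivial, hh⟩
  rw [num_and (fun _ : V => True) (fun s : Fin 3 × Fin m → V => IsHom R s),
    num_prod (fun y (s : Fin 3 × Fin m → V) => IsHom R (Function.update s (0, 0) y))] at k1
  have k2 : num (fun _ : V => True) = Fintype.card V := by simp [num]
  rw [k2, ← Nat.cast_le (α := ℝ)] at k1
  push_cast at k1
  refine le_of_mul_le_mul_left (le_trans ?_ k1) (by exact_mod_cast hV : (0 : ℝ) < Fintype.card V)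
  calc (Fintype.card V : ℝ) * (c * (Fintype.card V : ℝ) ^ (3 * m)) =
      ∑ _x : V, c * (Fintype.card V : ℝ) ^ (3 * m) := by simp
    _ ≤ _ := by
      refine Finset.sum_le_sum (fun x _ => ?_)
      obtain ⟨y, hy⟩ := h x
      refine hy.trans ?_
      exact Nat.cast_le.mpr (num_mono fun s hs => hs.1)

lemma num_absorber {R : V → V → V → Prop} {c c' : ℝ} (hV : 0 < Fintype.card V) (hc' : 0 ≤ c')
    (hhom : c * (Fintype.card V : ℝ) ^ (3 * m) ≤ num (fun s : Fin 3 × Fin m → V => IsHom R s))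
    (hchain : ∀ x z, c' * (Fintype.card V : ℝ) ^ (3 * (3 * m)) ≤ Fintype.card V *
      (num (fun σ : Fin 3 × (Fin 3 × Fin m) → V => IsLinkChain R x σ ∧ σ (2, (0, 0)) = z) : ℝ))
    (u : Fin 3 × Fin m → V) :
    c * c' ^ (3 * m) * (Fintype.card V : ℝ) ^ (3 * m * (3 * (3 * m))) ≤
      num (fun ω => IsAbsorber R u ω) := by
  classical
  have hn : (0 : ℝ) < (Fintype.card V : ℝ) := by exact_mod_cast hV
  have k1 : num (fun q : (Fin 3 × Fin m → V) × ((Fin 3 × Fin m) → Fin 3 × (Fin 3 × Fin m) → V) =>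
      IsHom R q.1 ∧ ∀ w, IsLinkChain R (u w) (q.2 w) ∧ q.2 w (2, (0, 0)) = q.1 w) ≤
      num (fun ω => IsAbsorber R u ω) := by
    refine num_le_of_injOn (fun q p => q.2 p.1 p.2) ?_ ?_
    · rintro ⟨a, f⟩ ⟨a', f'⟩ ⟨-, ha⟩ ⟨-, ha'⟩ hh
      have hf : f = f' := by
        funext w p
        exact congrFun hh (w, p)
      subst hf
      have : a = a' := by
        funext w
        exact (ha w).2.symm.trans (ha' w).2
      rw [this]
    · rintro ⟨a, f⟩ ⟨ha, hf⟩
      refine ⟨fun w => (hf w).1, ?_⟩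
      have : (fun w => f w (2, (0, 0))) = a := funext fun w => (hf w).2
      change IsHom R (fun w => f w (2, (0, 0)))
      rwa [this]
  rw [num_prod (fun a (f : (Fin 3 × Fin m) → Fin 3 × (Fin 3 × Fin m) → V) =>
      IsHom R a ∧ ∀ w, IsLinkChain R (u w) (f w) ∧ f w (2, (0, 0)) = a w),
      ← Nat.cast_le (α := ℝ)] at k1
  push_cast at k1
  have k2 : ∀ a : Fin 3 × Fin m → V, (c' * (Fintype.card V : ℝ) ^ (3 * (3 * m))) ^ (3 * m) ≤
      (Fintype.card V : ℝ) ^ (3 * m) * (num (fun f : (Fin 3 × Fin m) → Fin 3 × (Fin 3 × Fin m) → V =>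
        ∀ w, IsLinkChain R (u w) (f w) ∧ f w (2, (0, 0)) = a w) : ℝ) := by
    intro a
    rw [num_pi (fun w (σ : Fin 3 × (Fin 3 × Fin m) → V) =>
      IsLinkChain R (u w) σ ∧ σ (2, (0, 0)) = a w)]
    push_cast
    have hcard : Fintype.card (Fin 3 × Fin m) = 3 * m := by simp
    have hprod : ∀ b : ℝ, b ^ (3 * m) = ∏ _w : Fin 3 × Fin m, b := fun b => by
      rw [Finset.prod_const, Finset.card_univ, hcard]
    rw [hprod (c' * _), hprod (Fintype.card V : ℝ), ← Finset.prod_mul_distrib]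
    exact Finset.prod_le_prod (fun w _ => by positivity) (fun w _ => hchain _ _)
  have k3 : (num (fun s : Fin 3 × Fin m → V => IsHom R s) : ℝ) *
      (c' * (Fintype.card V : ℝ) ^ (3 * (3 * m))) ^ (3 * m) ≤ (Fintype.card V : ℝ) ^ (3 * m) *
      num (fun ω => IsAbsorber R u ω) := by
    refine le_trans ?_ (mul_le_mul_of_nonneg_left k1 (by positivity))
    rw [num_eq_sum]
    push_cast
    rw [Finset.sum_mul, Finset.mul_sum]
    refine Finset.sum_le_sum (fun a _ => ?_)
    split_ifs with ha
    · simpa only [ha, true_and, one_mul] using k2 a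
    · rw [zero_mul]
      positivity
  refine le_of_mul_le_mul_left ?_ (by positivity : 0 < (Fintype.card V : ℝ) ^ (3 * m))
  refine le_trans (le_of_eq ?_) ((mul_le_mul_of_nonneg_right hhom (by positivity)).trans k3)
  rw [mul_pow, ← pow_mul, mul_comm (3 * (3 * m)) (3 * m)]
  ring

/-- Every `3m` vertices have many absorbers. -/
lemma exists_num_absorber (m : ℕ) [NeZero m] {γ : ℝ} (hγ : 0 < γ) (hγ1 : γ ≤ 1) :
    ∃ ξ : ℝ, 0 < ξ ∧ ∃ n₀ : ℕ, ∀ (V : Type) [Fintype V], n₀ ≤ Fintype.card V →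
      ∀ R : V → V → V → Prop,
      (∀ x, (1 / 2 + γ) * (Fintype.card V : ℝ) ^ 2 ≤ num (fun p : V × V => R x p.1 p.2)) →
      ∀ u : Fin 3 × Fin m → V,
      ξ * Fintype.card ((Fin 3 × Fin m) × (Fin 3 × (Fin 3 × Fin m)) → V) ≤
        num (fun ω : (Fin 3 × Fin m) × (Fin 3 × (Fin 3 × Fin m)) → V =>
          IsAbsorber R u ω ∧ Function.Injective ω ∧ ¬ ∃ p w, ω p = u w) := by
  classical
  set c := (γ ^ 2 / 2 * (γ ^ 3 / 8)) ^ (m ^ 3) with hc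
  have hc0 : 0 < c := by positivity
  set c' := (γ ^ 2 / 4) ^ 2 * c ^ 3 with hc'
  have hc'0 : 0 < c' := by positivity
  set ξ := c * c' ^ (3 * m) with hξ
  have hξ0 : 0 < ξ := by positivity
  set J := (Fin 3 × Fin m) × (Fin 3 × (Fin 3 × Fin m)) with hJ
  set t := Fintype.card J with ht
  refine ⟨ξ / 2, by positivity, max 1 ⌈2 * (t ^ 2 + t * (3 * m)) / ξ⌉₊,
    fun V _ hV R hR u => ?_⟩
  have hV1 : 0 < Fintype.card V := lt_of_lt_of_le one_pos ((le_max_left _ _).trans hV)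
  have hV2 : 2 * ((t : ℝ) ^ 2 + t * (3 * m)) ≤ ξ * Fintype.card V := by
    have h1 : ⌈2 * ((t : ℝ) ^ 2 + t * (3 * m)) / ξ⌉₊ ≤ Fintype.card V :=
      (le_max_right _ _).trans hV
    have h2 : 2 * ((t : ℝ) ^ 2 + t * (3 * m)) / ξ ≤ Fintype.card V :=
      (Nat.le_ceil _).trans (by exact_mod_cast h1)
    rw [div_le_iff₀ hξ0] at h2
    linarith
  have hn : (0 : ℝ) < (Fintype.card V : ℝ) := by exact_mod_cast hV1
  obtain ⟨Ty, hT1, hT2⟩ := exists_typical hγ hγ1 hR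
  have h1 : ∀ x, γ ^ 2 / 4 * Fintype.card V ≤ (num (fun y => Linked m c R x y ∧ Ty y) : ℝ) := by
    intro x
    refine (hT1 x).trans ?_
    exact Nat.cast_le.mpr (num_mono fun y hy => ⟨hy.1.linked hγ, hy.2⟩)
  have h2 : ∀ y y', Ty y → Ty y' → Linked m c R y y' :=
    fun y y' hy hy' => (hT2 y y' hy hy').linked hγ
  have h3 : ∀ x y, Linked m c R x y → Linked m c R y x := by
    intro x y h
    unfold Linked at h ⊢
    exact h.trans (Nat.cast_le.mpr (num_mono fun s hs => hs.symm))
  have h4 : ∀ x, ∃ y, Linked m c R x y := by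
    intro x
    have h5 : (0 : ℝ) < num (fun y => Linked m c R x y ∧ Ty y) :=
      lt_of_lt_of_le (by positivity) (h1 x)
    have h6 : num (fun _ : V => False) < num (fun y => Linked m c R x y ∧ Ty y) := by
      have : num (fun _ : V => False) = 0 := by simp [num]
      rw [this]
      exact_mod_cast h5
    obtain ⟨y, hy, -⟩ := exists_of_lt_num h6
    exact ⟨y, hy.1⟩
  have h5 := num_absorber hV1 hc'0.le (num_hom hV1 h4)
    (num_chain hc0.le (by positivity) h1 h2 h3) u
  have ht' : 3 * m * (3 * (3 * m)) = t := by simp [ht, hJ]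
  rw [ht', ← hξ] at h5
  have h6 := num_not_injective_mul_le (ι := J) (α := V)
  have h7 := num_exists_apply_eq_mul_le (ι := J) u
  have h8 : num (fun ω : J → V => IsAbsorber R u ω) ≤
      num (fun ω : J → V => (IsAbsorber R u ω ∧ Function.Injective ω ∧ ¬ ∃ p w, ω p = u w) ∨
        (¬ Function.Injective ω ∨ ∃ p w, ω p = u w)) := num_mono (by
    intro ω hω
    by_cases c1 : Function.Injective ω
    · by_cases c2 : ∃ p w, ω p = u w
      · exact Or.inr (Or.inr c2)
      · exact Or.inl ⟨hω, c1, c2⟩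
    · exact Or.inr (Or.inl c1))
  have h9 := h8.trans ((num_or_le _ _).trans (Nat.add_le_add_left (num_or_le _ _) _))
  have hcw : Fintype.card (Fin 3 × Fin m) = 3 * m := by simp
  rw [← ht] at h6
  rw [← ht, hcw] at h7
  rw [← Nat.cast_le (α := ℝ)] at h6 h7 h9
  push_cast at h6 h7 h9
  rw [Fintype.card_fun, ← ht]
  push_cast
  refine le_of_mul_le_mul_right ?_ hn
  have h10 := mul_le_mul_of_nonneg_right (h5.trans h9) hn.le
  have h11 := mul_le_mul_of_nonneg_right hV2
    (by positivity : 0 ≤ (Fintype.card V : ℝ) ^ t)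
  linarith

end Absorbers

section Tiled

variable {V : Type} {m : ℕ}

/-- `S` can be partitioned into copies of the complete tripartite graph. -/
def Tiled (R : V → V → V → Prop) (m : ℕ) (S : Set V) : Prop :=
  ∃ (K : Type) (_ : Fintype K) (τ : K × Fin 3 × Fin m → V), IsTiling R m τ ∧ Set.range τ = S

lemma Tiled.iUnion {R : V → V → V → Prop} {ι : Type} [Fintype ι] {S : ι → Set V}
    (h : ∀ i, Tiled R m (S i)) (hS : ∀ i j, i ≠ j → Disjoint (S i) (S j)) :
    Tiled R m (⋃ i, S i) := by
  choose K hK τ hτ hr using h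
  refine ⟨Σ i, K i, inferInstance, fun p => τ p.1.1 (p.1.2, p.2), ⟨?_, ?_⟩, ?_⟩
  · rintro ⟨⟨i, k⟩, v⟩ ⟨⟨i', k'⟩, v'⟩ hh
    simp only at hh
    have hi : i = i' := by
      by_contra hne
      have h1 : τ i (k, v) ∈ S i := hr i ▸ Set.mem_range_self _
      have h2 : τ i' (k', v') ∈ S i' := hr i' ▸ Set.mem_range_self _
      exact Set.disjoint_left.mp (hS i i' hne) h1 (hh ▸ h2)
    subst hi
    have := (hτ i).1 hh
    simp only [Prod.mk.injEq] at this
    rw [this.1, this.2]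
  · rintro ⟨i, k⟩
    exact (hτ i).2 k
  · ext x
    simp only [Set.mem_range, Set.mem_iUnion, Prod.exists, Sigma.exists, ← hr]

lemma Tiled.union {R : V → V → V → Prop} {S T : Set V} (hS : Tiled R m S) (hT : Tiled R m T)
    (h : Disjoint S T) : Tiled R m (S ∪ T) := by
  rw [Set.union_eq_iUnion]
  refine Tiled.iUnion (fun b => ?_) (fun b b' hb => ?_)
  · cases b
    · exact hT
    · exact hS
  · cases b <;> cases b'
    · exact absurd rfl hb
    · exact h.symm
    · exact h
    · exact absurd rfl hb

variable [NeZero m]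

lemma IsAbsorber.tiled_range {R : V → V → V → Prop} {u : Fin 3 × Fin m → V}
    {ω : (Fin 3 × Fin m) × (Fin 3 × (Fin 3 × Fin m)) → V} (h : IsAbsorber R u ω)
    (hω : Function.Injective ω) : Tiled R m (Set.range ω) := by
  refine ⟨(Fin 3 × Fin m) × Fin 3, inferInstance, fun p => ω (p.1.1, (p.1.2, p.2)), ⟨?_, ?_⟩, ?_⟩
  · rintro ⟨⟨w, i⟩, v⟩ ⟨⟨w', i'⟩, v'⟩ hh
    have := hω hh
    simp only [Prod.mk.injEq] at this ⊢
    tauto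
  · rintro ⟨w, i⟩
    exact (h.1 w).1 i
  · ext x
    simp only [Set.mem_range, Prod.exists]

/-- The cells of the tiling of the vertices of an absorber together with the absorbed ones. -/
def absorbCell (m : ℕ) [NeZero m] :
    ((Fin 3 × Fin m) × Fin 3 ⊕ Unit) × (Fin 3 × Fin m) →
      ((Fin 3 × Fin m) × (Fin 3 × (Fin 3 × Fin m))) ⊕ (Fin 3 × Fin m)
  | (.inl (w, i), v) => if v = (0, 0) then
      (if i = 0 then .inr w else if i = 1 then .inl (w, (0, (0, 0))) else .inl (w, (1, (0, 0))))
      else .inl (w, (i, v))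
  | (.inr _, w) => .inl (w, (2, (0, 0)))

lemma bijective_absorbCell : Function.Bijective (absorbCell m) := by
  rw [Fintype.bijective_iff_surjective_and_card]
  constructor
  · rintro (⟨w, i, v⟩ | w)
    · by_cases hv : v = (0, 0)
      · subst hv
        match i with
        | 0 => exact ⟨(.inl (w, 1), (0, 0)), by simp [absorbCell]⟩
        | 1 => exact ⟨(.inl (w, 2), (0, 0)), by simp [absorbCell]⟩
        | 2 => exact ⟨(.inr (), w), rfl⟩
      · exact ⟨(.inl (w, i), v), by simp [absorbCell, hv]⟩
    · exact ⟨(.inl (w, 0), (0, 0)), by simp [absorbCell]⟩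
  · simp only [Fintype.card_prod, Fintype.card_sum, Fintype.card_fin, Fintype.card_unit]
    ring

lemma IsAbsorber.tiled_range_union {R : V → V → V → Prop} {u : Fin 3 × Fin m → V}
    {ω : (Fin 3 × Fin m) × (Fin 3 × (Fin 3 × Fin m)) → V} (h : IsAbsorber R u ω)
    (hω : Function.Injective ω) (hu : Function.Injective u) (hd : ¬ ∃ p w, ω p = u w) :
    Tiled R m (Set.range ω ∪ Set.range u) := by
  refine ⟨(Fin 3 × Fin m) × Fin 3 ⊕ Unit, inferInstance,
    fun p => Sum.elim ω u (absorbCell m p), ⟨?_, ?_⟩, ?_⟩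
  · refine (hω.sumElim hu fun p w hpw => hd ⟨p, w, hpw⟩).comp bijective_absorbCell.1
  · have key : ∀ w i, (fun v => Sum.elim ω u (absorbCell m (.inl (w, i), v))) =
        Function.update (fun v => ω (w, (i, v))) (0, 0)
          (if i = 0 then u w else if i = 1 then ω (w, (0, (0, 0))) else ω (w, (1, (0, 0)))) := by
      intro w i
      funext v
      by_cases hv : v = (0, 0)
      · subst hv
        simp only [absorbCell, if_true, Function.update_self]
        split_ifs <;> rfl
      · simp [absorbCell, hv]
    rintro (⟨w, i⟩ | _)
    · have : IsHom R (fun v => Sum.elim ω u (absorbCell m (.inl (w, i), v))) := by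
        rw [key]
        match i with
        | 0 => exact (h.1 w).2.1
        | 1 => exact (h.1 w).2.2.1
        | 2 => exact (h.1 w).2.2.2
      exact this
    · exact h.2
  · change Set.range (Sum.elim ω u ∘ absorbCell m) = _
    rw [bijective_absorbCell.2.range_comp, Set.Sum.elim_range]

end Tiled

section Selection

variable {V J U : Type} [Fintype V] [Fintype J] [DecidableEq J] [Fintype U]

lemma exists_disjoint_family [Nonempty U] {A : U → (J → V) → Prop} {ξ : ℝ} (hξ : 0 < ξ)
    (hξ1 : ξ ≤ 1) (hA : ∀ u, ξ * (Fintype.card V : ℝ) ^ Fintype.card J ≤ num (A u)) (q : ℕ)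
    (hq : 2 * (q * (Fintype.card J : ℝ) ^ 2) ≤ ξ * Fintype.card V) (hV : 0 < Fintype.card V) :
    ∃ f : Fin q → J → V, (∀ i j, i ≠ j → ∀ p p', f i p ≠ f j p') ∧ (∀ i, ∃ u, A u (f i)) ∧
      ∑ u, (1 / 2 : ℝ) ^ num (fun i => A u (f i)) ≤ Fintype.card U * (1 - ξ / 4) ^ q := by
  classical
  have hn : (0 : ℝ) < (Fintype.card V : ℝ) := by exact_mod_cast hV
  induction q with
  | zero => exact ⟨fun i => i.elim0, fun i => i.elim0, fun i => i.elim0, by simp [num]⟩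
  | succ q ih =>
    push_cast at hq
    obtain ⟨f, hf1, hf2, hf3⟩ := ih (by nlinarith [sq_nonneg (Fintype.card J : ℝ)])
    set w : U → ℝ := fun u => (1 / 2 : ℝ) ^ num (fun i => A u (f i)) with hw
    have hw0 : ∀ u, 0 < w u := fun u => by positivity
    set N : ℝ := (Fintype.card V : ℝ) ^ Fintype.card J with hN
    have hN0 : 0 < N := by positivity
    let B : (J → V) → Prop := fun g => ∃ p, ∃ b : Fin q × J, g p = f b.1 b.2
    have hB : (num B : ℝ) ≤ ξ / 2 * N := by
      have h := num_exists_apply_eq_mul_le (ι := J) (fun b : Fin q × J => f b.1 b.2)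
      rw [← Nat.cast_le (α := ℝ)] at h
      push_cast at h
      rw [Fintype.card_prod, Fintype.card_fin] at h
      push_cast at h
      refine le_of_mul_le_mul_right (h.trans ?_) hn
      rw [← hN]
      nlinarith [sq_nonneg (Fintype.card J : ℝ)]
    have hA' : ∀ u, ξ / 2 * N ≤ num (fun g => A u g ∧ ¬ B g) := by
      intro u
      have h1 : num (A u) ≤ num (fun g => A u g ∧ ¬ B g) + num B := by
        refine le_trans (num_mono fun g hg => ?_) (num_or_le _ _)
        by_cases hB : B g
        · exact Or.inr hB
        · exact Or.inl ⟨hg, hB⟩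
      rw [← Nat.cast_le (α := ℝ)] at h1
      push_cast at h1
      linarith [hA u]
    obtain ⟨g, hg⟩ : ∃ g : J → V,
        ξ / 2 * ∑ u, w u ≤ ∑ u, w u * (if A u g ∧ ¬ B g then 1 else 0) := by
      have : Nonempty V := Fintype.card_pos_iff.mp hV
      obtain ⟨g, -, hg⟩ := Finset.exists_le_of_sum_le (s := (Finset.univ : Finset (J → V)))
        (f := fun _ => ξ / 2 * ∑ u, w u)
        (g := fun g => ∑ u, w u * (if A u g ∧ ¬ B g then 1 else 0)) Finset.univ_nonempty (by
        rw [Finset.sum_comm, Finset.sum_const, Finset.card_univ, Fintype.card_fun, nsmul_eq_mul]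
        push_cast
        rw [← hN, ← mul_assoc, Finset.mul_sum]
        refine Finset.sum_le_sum fun u _ => ?_
        rw [← Finset.mul_sum]
        have := hA' u
        rw [num_eq_sum] at this
        push_cast at this
        nlinarith [hw0 u])
      exact ⟨g, hg⟩
    have hW : 0 < ∑ u, w u := Finset.sum_pos (fun u _ => hw0 u) Finset.univ_nonempty
    obtain ⟨u₀, hu₀⟩ : ∃ u, A u g ∧ ¬ B g := by
      by_contra hcon
      push Not at hcon
      have : ∑ u, w u * (if A u g ∧ ¬ B g then (1 : ℝ) else 0) = 0 :=
        Finset.sum_eq_zero fun u _ => by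
          rw [if_neg (fun h => h.2 (hcon u h.1)), mul_zero]
      nlinarith
    have hgB : ∀ p i p', g p ≠ f i p' := fun p i p' h => hu₀.2 ⟨p, (i, p'), h⟩
    refine ⟨Fin.cons g f, ?_, ?_, ?_⟩
    · intro i j
      refine Fin.cases ?_ (fun i => ?_) i <;> refine Fin.cases ?_ (fun j => ?_) j
      · intro h
        exact absurd rfl h
      · intro _ p p'
        simpa using hgB p j p'
      · intro _ p p'
        simpa using (hgB p' i p).symm
      · intro h p p'
        simpa using hf1 i j (fun h' => h (by rw [h'])) p p'
    · intro i
      refine Fin.cases ⟨u₀, by simpa using hu₀.1⟩ (fun i => ?_) i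
      simpa using hf2 i
    · have h1 : ∀ u, (1 / 2 : ℝ) ^ num (fun i => A u ((Fin.cons g f : Fin (q + 1) → J → V) i)) ≤
          w u - 1 / 2 * (w u * (if A u g ∧ ¬ B g then 1 else 0)) := by
        intro u
        have h2 : num (fun i => A u ((Fin.cons g f : Fin (q + 1) → J → V) i)) =
            (if A u g then 1 else 0) + num (fun i => A u (f i)) := by
          rw [num_eq_sum, num_eq_sum, Fin.sum_univ_succ]
          simp
        rw [h2, pow_add]
        have h3 : (1 / 2 : ℝ) ^ num (fun i => A u (f i)) = w u := rfl
        rw [h3]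
        have := hw0 u
        by_cases c1 : A u g
        · by_cases c2 : B g
          · simp only [c1, c2, if_true, not_true_eq_false, and_false, if_false]
            linarith
          · simp only [c1, c2, if_true, not_false_eq_true, and_true]
            linarith
        · simp [c1]
      refine (Finset.sum_le_sum fun u _ => h1 u).trans ?_
      rw [Finset.sum_sub_distrib, ← Finset.mul_sum, pow_succ, ← mul_assoc]
      have h4 : 0 ≤ 1 - ξ / 4 := by linarith
      nlinarith [mul_le_mul_of_nonneg_right hf3 h4]

/-- If every element of a set of polynomial size is served by a positive proportion of the maps
`J → V`, then some disjoint maps serve each element linearly many times. -/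
lemma exists_disjoint_family_of_card_le (t d : ℕ) {ξ β₀ : ℝ} (hξ : 0 < ξ) (hβ₀ : 0 < β₀) :
    ∃ ρ : ℝ, 0 < ρ ∧ ∃ n₀ : ℕ, ∀ (V J U : Type) [Fintype V] [Fintype J] [DecidableEq J] [Fintype U]
        [Nonempty U],
      n₀ ≤ Fintype.card V → Fintype.card J = t → Fintype.card U ≤ Fintype.card V ^ d →
      ∀ A : U → (J → V) → Prop, (∀ u, ξ * Fintype.card (J → V) ≤ num (A u)) →
      ∃ (q : ℕ) (f : Fin q → J → V), (∀ i j, i ≠ j → ∀ p p', f i p ≠ f j p') ∧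
        (∀ i, ∃ u, A u (f i)) ∧ (q : ℝ) ≤ β₀ * Fintype.card V ∧
        ∀ u, ρ * Fintype.card V ≤ num (fun i => A u (f i)) := by
  set ξ' := min ξ 1 with hξ'
  have hξ0 : 0 < ξ' := lt_min hξ one_pos
  have hξ1 : ξ' ≤ 1 := min_le_right _ _
  set β := min β₀ (ξ' / (2 * ((t : ℝ) ^ 2 + 1))) with hβ
  have hβ0 : 0 < β := lt_min hβ₀ (by positivity)
  have hβt : 2 * (β * ((t : ℝ) ^ 2)) ≤ ξ' := by
    have h := min_le_right β₀ (ξ' / (2 * ((t : ℝ) ^ 2 + 1)))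
    rw [← hβ, le_div_iff₀ (by positivity)] at h
    linarith
  have hlog : ∀ᶠ x : ℝ in Filter.atTop, d * Real.log x ≤ ξ' * β / 16 * x := by
    have h := Real.isLittleO_log_id_atTop.bound
      (by positivity : (0 : ℝ) < ξ' * β / (16 * (d + 1)))
    filter_upwards [h, Filter.eventually_ge_atTop (1 : ℝ)] with x hx hx1
    have hl : 0 ≤ Real.log x := Real.log_nonneg hx1
    rw [id, Real.norm_of_nonneg hl, Real.norm_of_nonneg (by linarith)] at hx
    calc d * Real.log x ≤ (d + 1) * Real.log x := by nlinarith
      _ ≤ (d + 1) * (ξ' * β / (16 * (d + 1)) * x) := by gcongr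
      _ = _ := by field_simp
  obtain ⟨n₁, hn₁⟩ := Filter.eventually_atTop.mp (tendsto_natCast_atTop_atTop.eventually hlog)
  refine ⟨ξ' * β / 8, by positivity, max n₁ (max 1 ⌈4 / β⌉₊), ?_⟩
  intro V J U _ _ _ _ _ hV hJ hU A hA
  have hV0 : 1 ≤ Fintype.card V := (le_max_left _ _).trans ((le_max_right _ _).trans hV)
  have hV1 := hn₁ _ ((le_max_left _ _).trans hV)
  have hV2 : 4 ≤ β * Fintype.card V := by
    have h1 : ⌈4 / β⌉₊ ≤ Fintype.card V :=
      (le_max_right 1 ⌈4 / β⌉₊).trans ((le_max_right _ _).trans hV)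
    have h2 := (Nat.le_ceil (4 / β)).trans (Nat.cast_le.mpr h1)
    rw [div_le_iff₀ hβ0] at h2
    linarith
  have hn : (0 : ℝ) < (Fintype.card V : ℝ) := by exact_mod_cast hV0
  set q := ⌊β * Fintype.card V⌋₊ with hq
  have hq1 : (q : ℝ) ≤ β * Fintype.card V := Nat.floor_le (by positivity)
  have hq2 : β * Fintype.card V < q + 1 := Nat.lt_floor_add_one _
  obtain ⟨f, hf1, hf2, hf3⟩ := exists_disjoint_family (A := A) hξ0 hξ1 (fun u => by
    have h := hA u
    rw [Fintype.card_fun] at h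
    push_cast at h
    refine le_trans ?_ h
    gcongr
    exact min_le_left _ _) q (by
    rw [hJ]
    nlinarith [sq_nonneg (t : ℝ)]) hV0
  refine ⟨q, f, hf1, hf2, hq1.trans (by gcongr; exact min_le_left _ _), fun u => ?_⟩
  set k := num (fun i => A u (f i)) with hk
  have h1 : (1 / 2 : ℝ) ^ k ≤ Fintype.card U * (1 - ξ' / 4) ^ q :=
    (Finset.single_le_sum (f := fun u => (1 / 2 : ℝ) ^ num (fun i => A u (f i)))
      (fun u _ => by positivity) (Finset.mem_univ u)).trans hf3
  have h2 : Real.exp (-k) ≤ (1 / 2 : ℝ) ^ k := by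
    have : Real.exp (-(k : ℝ)) = Real.exp (-1) ^ k := by
      rw [← Real.exp_nat_mul]
      ring_nf
    rw [this]
    gcongr
    rw [Real.exp_neg, one_div]
    gcongr
    linarith [Real.add_one_le_exp (1 : ℝ)]
  have h3 : (1 - ξ' / 4) ^ q ≤ Real.exp (-(ξ' / 4 * q)) := by
    have : Real.exp (-(ξ' / 4 * q)) = Real.exp (-(ξ' / 4)) ^ q := by
      rw [← Real.exp_nat_mul]
      ring_nf
    rw [this]
    have h4 := Real.add_one_le_exp (-(ξ' / 4))
    exact pow_le_pow_left₀ (by linarith) (by linarith) _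
  have h4 : (Fintype.card U : ℝ) ≤ Real.exp (d * Real.log (Fintype.card V)) := by
    rw [Real.exp_nat_mul, Real.exp_log hn]
    exact_mod_cast hU
  have h5 : Real.exp (-k) ≤ Real.exp (d * Real.log (Fintype.card V) + -(ξ' / 4 * q)) := by
    rw [Real.exp_add]
    refine h2.trans (h1.trans ?_)
    gcongr
    · exact pow_nonneg (by linarith) _
  rw [Real.exp_le_exp] at h5
  nlinarith

end Selection

section Assembly

lemma exists_injective_choice {ι : Type} [Fintype ι] {q : ℕ} {P : ι → Fin q → Prop}
    (h : ∀ i, Fintype.card ι ≤ num (P i)) :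
    ∃ e : ι → Fin q, Function.Injective e ∧ ∀ i, P i (e i) := by
  classical
  obtain ⟨e, he, hP⟩ := (Finset.all_card_le_biUnion_card_iff_exists_injective
    (fun i => Finset.univ.filter (P i))).mp (by
      intro s
      obtain rfl | ⟨i, hi⟩ := s.eq_empty_or_nonempty
      · simp
      · refine s.card_le_univ.trans ((h i).trans ?_)
        refine le_trans (le_of_eq ?_) (Finset.card_le_card
          (Finset.subset_biUnion_of_mem (fun i => Finset.univ.filter (P i)) hi))
        unfold num
        congr)
  exact ⟨e, he, fun i => by simpa using hP i⟩

lemma card_notMem_range_add {α V : Type} [Fintype α] [Fintype V] {f : α → V}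
    (hf : Function.Injective f) [Fintype {v // v ∉ Set.range f}] :
    Fintype.card {v // v ∉ Set.range f} + Fintype.card α = Fintype.card V := by
  classical
  rw [← Fintype.card_congr (Equiv.ofInjective f hf).symm, add_comm, ← Fintype.card_sum]
  exact Fintype.card_congr (Equiv.sumCompl (· ∈ Set.range f))

lemma num_link_subtype {V : Type} [Fintype V] {R : V → V → V → Prop} {W : V → Prop}
    [Fintype {v // ¬ W v}] (x : {v // ¬ W v}) :
    num (fun p : V × V => R x p.1 p.2) ≤
      num (fun p : {v // ¬ W v} × {v // ¬ W v} => R x p.1 p.2) +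
        2 * (num W * Fintype.card V) := by
  classical
  have h1 : num (fun p : V × V => R x p.1 p.2) ≤
      num (fun p : V × V => (R x p.1 p.2 ∧ ¬ W p.1 ∧ ¬ W p.2) ∨
        ((W p.1 ∧ True) ∨ (True ∧ W p.2))) := num_mono fun p hp => by tauto
  have h2 := h1.trans ((num_or_le _ _).trans (Nat.add_le_add_left (num_or_le _ _) _))
  rw [num_and W (fun _ : V => True), num_and (fun _ : V => True) W] at h2
  have h3 : num (fun _ : V => True) = Fintype.card V := by simp [num]
  rw [h3] at h2
  have h4 : num (fun p : V × V => R x p.1 p.2 ∧ ¬ W p.1 ∧ ¬ W p.2) ≤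
      num (fun p : {v // ¬ W v} × {v // ¬ W v} => R x p.1 p.2) := by
    let g : V → {v // ¬ W v} := fun v => if h : ¬ W v then ⟨v, h⟩ else x
    have hg : ∀ v, ¬ W v → (g v : V) = v := fun v hv => by simp only [g, hv, not_false_eq_true,
      dif_pos]
    refine num_le_of_injOn (fun p => (g p.1, g p.2)) ?_ ?_
    · rintro ⟨a, b⟩ ⟨a', b'⟩ ⟨-, ha, hb⟩ ⟨-, ha', hb'⟩ h
      simp only [Prod.mk.injEq] at h
      rw [← hg a ha, ← hg b hb, ← hg a' ha', ← hg b' hb', h.1, h.2]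
    · rintro ⟨a, b⟩ ⟨hr, ha, hb⟩
      change R x (g a) (g b)
      rwa [hg a ha, hg b hb]
  have h5 : Fintype.card V * num W = num W * Fintype.card V := mul_comm _ _
  omega

variable {m : ℕ}

/-- The covering step: disjoint absorbers, an almost perfect tiling of the remaining vertices, and
enough absorbers for the leftover vertices. -/
lemma tiled_univ_of_absorbers [NeZero m] {V : Type} [Fintype V] (hm : 3 * m ∣ Fintype.card V)
    {R : V → V → V → Prop} {q k : ℕ}
    {f : Fin q → (Fin 3 × Fin m) × (Fin 3 × (Fin 3 × Fin m)) → V}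
    (hf : ∀ i j, i ≠ j → ∀ p p', f i p ≠ f j p')
    (hA : ∀ i, ∃ u, IsAbsorber R u (f i) ∧ Function.Injective (f i))
    (hk : ∀ u : Fin 3 × Fin m → V, k ≤ num (fun i => IsAbsorber R u (f i) ∧
      Function.Injective (f i) ∧ ¬ ∃ p w, f i p = u w))
    {K : Type} [Fintype K] {τ : K × Fin 3 × Fin m → V} (hτ : IsTiling R m τ)
    (hfτ : ∀ i p x, f i p ≠ τ x)
    (hK : Fintype.card V ≤ q * (3 * m * (3 * (3 * m))) + 3 * m * Fintype.card K + k) :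
    Tiled R m (Set.univ : Set V) := by
  classical
  have hm0 : 0 < m := Nat.pos_of_ne_zero (NeZero.ne m)
  have hfi : ∀ i, Function.Injective (f i) := fun i => (hA i).choose_spec.2
  set Ψ : (Fin q × ((Fin 3 × Fin m) × (Fin 3 × (Fin 3 × Fin m)))) ⊕ (K × Fin 3 × Fin m) → V :=
    Sum.elim (fun x => f x.1 x.2) τ with hΨ
  have hΨi : Function.Injective Ψ := by
    refine Function.Injective.sumElim ?_ hτ.1 (fun a b => hfτ _ _ _)
    rintro ⟨i, p⟩ ⟨j, p'⟩ h
    by_cases hij : i = j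
    · subst hij
      exact Prod.ext rfl (hfi i h)
    · exact absurd h (hf i j hij p p')
  have hcard := card_notMem_range_add hΨi
  simp only [Fintype.card_sum, Fintype.card_prod, Fintype.card_fin] at hcard
  obtain ⟨p, hp⟩ : 3 * m ∣ Fintype.card {v // v ∉ Set.range Ψ} := by
    rw [← hcard] at hm
    refine (Nat.dvd_add_left ?_).mp hm
    exact ⟨q * (3 * (3 * m)) + Fintype.card K, by ring⟩
  have e : Fin p × (Fin 3 × Fin m) ≃ {v // v ∉ Set.range Ψ} :=
    Fintype.equivOfCardEq (by
      rw [hp, Fintype.card_prod, Fintype.card_prod, Fintype.card_fin, Fintype.card_fin,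
        Fintype.card_fin, mul_comm])
  have hpk : p ≤ k := by
    have h1 : p ≤ 3 * m * p := Nat.le_mul_of_pos_left _ (by positivity)
    have h2 : Fintype.card K * (3 * m) = 3 * m * Fintype.card K := mul_comm _ _
    omega
  let u : Fin p → Fin 3 × Fin m → V := fun j w => e (j, w)
  have hu : ∀ j, Function.Injective (u j) := fun j w w' h => by
    have := e.injective (Subtype.ext h)
    simpa using this
  have hu' : ∀ j w, u j w ∉ Set.range Ψ := fun j w => (e (j, w)).2
  obtain ⟨c, hc, hcA⟩ := exists_injective_choice
    (P := fun (j : Fin p) (i : Fin q) => IsAbsorber R (u j) (f i) ∧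
      Function.Injective (f i) ∧ ¬ ∃ x w, f i x = u j w)
    (fun j => by
      rw [Fintype.card_fin]
      exact hpk.trans (hk _))
  let D : Fin q → Set V := fun i => {v | ∃ j, c j = i ∧ v ∈ Set.range (u j)}
  have hDΨ : ∀ i v, v ∈ D i → v ∉ Set.range Ψ := by
    rintro i v ⟨j, -, w, rfl⟩
    exact hu' j w
  have hfΨ : ∀ i x, f i x ∈ Set.range Ψ := fun i x => ⟨.inl (i, x), rfl⟩
  have hτΨ : ∀ x, τ x ∈ Set.range Ψ := fun x => ⟨.inr x, rfl⟩
  have hT : ∀ i, Tiled R m (Set.range (f i) ∪ D i) := by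
    intro i
    by_cases hi : ∃ j, c j = i
    · obtain ⟨j, rfl⟩ := hi
      have hD : D (c j) = Set.range (u j) := by
        ext v
        constructor
        · rintro ⟨j', h, hv⟩
          rwa [← hc h]
        · exact fun hv => ⟨j, rfl, hv⟩
      rw [hD]
      exact (hcA j).1.tiled_range_union (hcA j).2.1 (hu j) (hcA j).2.2
    · have hD : D i = ∅ := Set.eq_empty_of_forall_notMem fun v ⟨j, hj, _⟩ => hi ⟨j, hj⟩
      rw [hD, Set.union_empty]
      obtain ⟨_, h1, h2⟩ := hA i
      exact h1.tiled_range h2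
  have hT' : ∀ i j, i ≠ j → Disjoint (Set.range (f i) ∪ D i) (Set.range (f j) ∪ D j) := by
    intro i j hij
    rw [Set.disjoint_left]
    rintro v (⟨x, rfl⟩ | hv) (⟨y, hy⟩ | hv')
    · exact hf j i hij.symm y x hy
    · exact hDΨ _ _ hv' (hfΨ i x)
    · exact hDΨ _ _ hv (hy ▸ hfΨ j y)
    · obtain ⟨a, ha, w, hw⟩ := hv
      obtain ⟨b, hb, w', hw'⟩ := hv'
      have h := e.injective (Subtype.ext (hw.trans hw'.symm))
      simp only [Prod.mk.injEq] at h
      exact hij (by rw [← ha, ← hb, h.1])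
  have hfin := (Tiled.iUnion hT hT').union (T := Set.range τ) ⟨K, inferInstance, τ, hτ, rfl⟩ (by
    rw [Set.disjoint_left]
    rintro v hv ⟨x, rfl⟩
    obtain ⟨i, ⟨y, hy⟩ | hv⟩ := Set.mem_iUnion.mp hv
    · exact hfτ _ _ _ hy
    · exact hDΨ _ _ hv (hτΨ x))
  convert hfin
  symm
  rw [Set.eq_univ_iff_forall]
  intro v
  by_cases hv : v ∈ Set.range Ψ
  · obtain ⟨⟨i, y⟩ | x, rfl⟩ := hv
    · exact Or.inl (Set.mem_iUnion.mpr ⟨i, Or.inl ⟨y, rfl⟩⟩)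
    · exact Or.inr ⟨x, rfl⟩
  · obtain ⟨⟨j, w⟩, hw⟩ := e.surjective ⟨v, hv⟩
    exact Or.inl (Set.mem_iUnion.mpr ⟨c j, Or.inr ⟨j, rfl, w, by simp only [u, hw]⟩⟩)

theorem exists_tiled_univ (m : ℕ) [NeZero m] {γ : ℝ} (hγ : 0 < γ) (hγ1 : γ ≤ 1) :
    ∃ n₀ : ℕ, ∀ (V : Type) [Fintype V], n₀ ≤ Fintype.card V → 3 * m ∣ Fintype.card V →
      ∀ R : V → V → V → Prop,
      (∀ x, (5 / 9 + γ) * (Fintype.card V : ℝ) ^ 2 ≤ num (fun p : V × V => R x p.1 p.2)) →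
      Tiled R m (Set.univ : Set V) := by
  classical
  have hm0 : 1 ≤ m := Nat.one_le_iff_ne_zero.mpr (NeZero.ne m)
  obtain ⟨ξ, hξ, n₁, hn₁⟩ := exists_num_absorber m hγ hγ1
  set J := (Fin 3 × Fin m) × (Fin 3 × (Fin 3 × Fin m)) with hJ
  set t := Fintype.card J with ht
  have ht' : t = 3 * m * (3 * (3 * m)) := by simp [ht, hJ]
  set β := γ / (4 * (t + 1)) with hβ
  have hβ0 : 0 < β := by positivity
  have hβt : t * β ≤ γ / 4 := by
    have : (t + 1) * β = γ / 4 := by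
      rw [hβ]
      field_simp
    linarith
  obtain ⟨ρ, hρ, n₂, hn₂⟩ := exists_disjoint_family_of_card_le t (3 * m) hξ hβ0
  obtain ⟨n₃, hn₃⟩ := tilesUpTo (half_pos hγ) (by linarith) hρ m hm0
  refine ⟨max 1 (max n₁ (max n₂ (2 * n₃))), fun V _ hV hdvd R hR => ?_⟩
  simp only [max_le_iff] at hV
  obtain ⟨hV0, hV1, hV2, hV3⟩ := hV
  have : Nonempty V := Fintype.card_pos_iff.mp hV0
  set n : ℝ := (Fintype.card V : ℝ) with hn
  have hn0 : 1 ≤ n := by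
    rw [hn]
    exact_mod_cast hV0
  have habs := hn₁ V hV1 R (fun x => le_trans (by
    gcongr ?_ * _
    linarith) (hR x))
  obtain ⟨q, f, hf1, hf2, hq, hf3⟩ := hn₂ V J (Fin 3 × Fin m → V) hV2 rfl (by simp) _ habs
  set F : Fin q × J → V := fun x => f x.1 x.2 with hF
  have hFi : Function.Injective F := by
    rintro ⟨i, p⟩ ⟨j, p'⟩ h
    by_cases hij : i = j
    · subst hij
      obtain ⟨_, -, h2, -⟩ := hf2 i
      exact Prod.ext rfl (h2 h)
    · exact absurd h (hf1 i j hij p p')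
  have hS := card_notMem_range_add hFi
  set S := {v // v ∉ Set.range F} with hSdef
  have hcF : Fintype.card (Fin q × J) = q * t := by simp [ht]
  rw [hcF] at hS
  have hqt : (q * t : ℝ) ≤ γ / 4 * n := by
    calc (q * t : ℝ) ≤ β * n * t := by gcongr
      _ = t * β * n := by ring
      _ ≤ _ := by gcongr
  have hS' : (Fintype.card S : ℝ) + q * t = n := by
    rw [hn]
    exact_mod_cast hS
  have hSn : n₃ ≤ Fintype.card S := by
    have h1 : (2 * n₃ : ℝ) ≤ n := by
      rw [hn]
      exact_mod_cast hV3
    have h2 : (n₃ : ℝ) ≤ Fintype.card S := by nlinarith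
    exact_mod_cast h2
  have hnumW : num (fun v => v ∈ Set.range F) ≤ q * t := by
    rw [← hcF]
    have h1 : num (fun v => v ∈ Set.range F) = Fintype.card (Set.range F) := by
      rw [← Set.toFinset_card]
      unfold num
      congr 1
      ext v
      simp
    rw [h1]
    exact Fintype.card_range_le F
  obtain ⟨K, hKf, τ, hτ, hK⟩ := hn₃ S hSn (fun x y z => R x y z) (by
    intro x
    have h1 := num_link_subtype (R := R) (W := fun v => v ∈ Set.range F) x
    have h2 : num (fun p : V × V => R x p.1 p.2) ≤
        num (fun p : S × S => R x p.1 p.2) + 2 * (q * t * Fintype.card V) :=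
      h1.trans (by gcongr)
    have h3 := hR x
    rw [← Nat.cast_le (α := ℝ)] at h2
    push_cast at h2
    rw [← hn] at h2
    have h4 : (Fintype.card S : ℝ) ≤ n := by
      have : (0 : ℝ) ≤ q * t := by positivity
      linarith
    have h5 : (q * t : ℝ) * n ≤ γ / 4 * n * n := by gcongr
    calc (5 / 9 + γ / 2) * (Fintype.card S : ℝ) ^ 2 ≤ (5 / 9 + γ / 2) * n ^ 2 := by gcongr
      _ ≤ _ := by nlinarith)
  refine tiled_univ_of_absorbers hdvd hf1
    (fun i => (hf2 i).imp fun u h => ⟨h.1, h.2.1⟩) (k := ⌈ρ * n⌉₊)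
    (fun u => Nat.ceil_le.mpr (hf3 u)) (K := K) (τ := fun x => (τ x : V))
    ⟨Subtype.val_injective.comp hτ.1, hτ.2⟩ (fun i p x h => (τ x).2 ⟨(i, p), h⟩) ?_
  rw [← ht', ← hS, ← Nat.cast_le (α := ℝ)]
  push_cast
  have h1 := Nat.le_ceil (ρ * n)
  have h4 : (Fintype.card S : ℝ) ≤ n := by
    have : (0 : ℝ) ≤ q * t := by positivity
    linarith
  nlinarith

variable {n : ℕ}

lemma exists_eq_of_mem_multipartiteEdges {e : Finset (Fin 3 × Fin m)}
    (he : e ∈ multipartiteEdges 3 m) : ∃ i j k, e = {(0, i), (1, j), (2, k)} := by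
  simp only [multipartiteEdges, Finset.mem_filter, Finset.mem_univ, true_and] at he
  have h : ∀ c : Fin 3, ∃ a : Fin m, e.filter (fun v => v.1 = c) = {(c, a)} := by
    intro c
    obtain ⟨⟨c', a⟩, ha⟩ := Finset.card_eq_one.mp (he c)
    have h1 : (c', a) ∈ e.filter (fun v => v.1 = c) := by simp [ha]
    have h2 : c' = c := (Finset.mem_filter.mp h1).2
    exact ⟨a, by rw [ha, h2]⟩
  choose a ha using h
  refine ⟨a 0, a 1, a 2, ?_⟩
  ext ⟨c, b⟩
  have h1 : (c, b) ∈ e ↔ b = a c := by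
    have h2 : (c, b) ∈ e.filter (fun v => v.1 = c) ↔ (c, b) ∈ ({(c, a c)} : Finset _) := by
      rw [ha]
    simpa using h2
  rw [h1]
  match c with
  | 0 => simp
  | 1 => simp
  | 2 => simp

lemma Tiled.hasFactorOn {E : Finset (Finset (Fin n))}
    (h : Tiled (fun x y z => ({x, y, z} : Finset (Fin n)) ∈ E) m Set.univ) :
    HasFactorOn E (multipartiteEdges 3 m) Finset.univ := by
  classical
  obtain ⟨K, _, τ, ⟨hinj, hτ⟩, hr⟩ := h
  have hk : ∀ k, Function.Injective (fun w => τ (k, w)) := fun k w w' hw => by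
    simpa using hinj hw
  refine ⟨Finset.univ.image (fun k => Finset.univ.image (fun w => τ (k, w))), ?_, ?_, ?_⟩
  · intro A hA
    obtain ⟨k, -, rfl⟩ := Finset.mem_image.mp hA
    refine ⟨⟨_, hk k⟩, by rw [Finset.map_eq_image]; rfl, fun e he => ?_⟩
    obtain ⟨a, b, c, rfl⟩ := exists_eq_of_mem_multipartiteEdges he
    simpa [Finset.map_insert] using hτ k a b c
  · intro A hA B hB hAB
    simp only [Finset.coe_image, Finset.coe_univ, Set.image_univ, Set.mem_range] at hA hB
    obtain ⟨k, rfl⟩ := hA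
    obtain ⟨k', rfl⟩ := hB
    simp only [Function.onFun, id]
    rw [Finset.disjoint_left]
    intro v hv hv'
    obtain ⟨w, -, rfl⟩ := Finset.mem_image.mp hv
    obtain ⟨w', -, h⟩ := Finset.mem_image.mp hv'
    have := hinj h
    simp only [Prod.mk.injEq] at this
    exact hAB (by rw [this.1])
  · ext v
    simp only [Finset.mem_biUnion, Finset.mem_image, Finset.mem_univ, true_and, iff_true, id]
    obtain ⟨⟨k, w⟩, rfl⟩ := Set.eq_univ_iff_forall.mp hr v
    exact ⟨_, ⟨k, rfl⟩, Finset.mem_image.mpr ⟨w, Finset.mem_univ _, rfl⟩⟩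

lemma two_mul_degOn_le (E : Finset (Finset (Fin n))) (v : Fin n) :
    2 * degOn E 3 {v} ≤ num (fun p : Fin n × Fin n => ({v, p.1, p.2} : Finset (Fin n)) ∈ E) := by
  classical
  let P : Finset (Fin n) → Prop := fun S => S.card = 2 ∧ S ∪ {v} ∈ E
  have h1 : degOn E 3 {v} ≤ num P := by
    have : num P = {S | P S}.ncard := by
      rw [Set.ncard_eq_toFinset_card']
      unfold num
      congr 1
      ext S
      simp
    rw [this]
    unfold degOn
    refine Set.ncard_le_ncard (fun S hS => ⟨by simpa using hS.1, hS.2.2⟩) (Set.toFinite _)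
  have h2 : ∀ S : Finset (Fin n), ∃ a : Fin n × Fin n, P S → a.1 ≠ a.2 ∧ S = {a.1, a.2} := by
    intro S
    by_cases hS : P S
    · obtain ⟨a, b, hab, h⟩ := Finset.card_eq_two.mp hS.1
      exact ⟨(a, b), fun _ => ⟨hab, h⟩⟩
    · exact ⟨(v, v), fun h => absurd h hS⟩
  choose a ha using h2
  have h3 : num (fun q : Finset (Fin n) × Bool => P q.1 ∧ True) ≤
      num (fun p : Fin n × Fin n => ({v, p.1, p.2} : Finset (Fin n)) ∈ E) := by
    refine num_le_of_injOn (fun q => if q.2 then a q.1 else (a q.1).swap) ?_ ?_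
    · rintro ⟨S, b⟩ ⟨S', b'⟩ ⟨hS, -⟩ ⟨hS', -⟩ h
      obtain ⟨h1, h2⟩ := ha S hS
      obtain ⟨h1', h2'⟩ := ha S' hS'
      simp only at h1 h1' h2 h2' h hS hS'
      have hSS : S = S' := by
        rw [h2, h2']
        cases b <;> cases b' <;> simp [Prod.ext_iff] at h <;> simp [h, Finset.pair_comm]
      subst hSS
      cases b <;> cases b' <;> simp [Prod.ext_iff] at h ⊢
      · exact h1 h.2
      · exact h1 h.1
    · rintro ⟨S, b⟩ ⟨hS, -⟩
      obtain ⟨-, h2⟩ := ha S hS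
      have h3 : ({v, (a S).1, (a S).2} : Finset (Fin n)) ∈ E := by
        have := hS.2
        simp only at this
        rw [h2, Finset.union_comm] at this
        exact this
      cases b
      · simpa [Finset.pair_comm] using h3
      · simpa using h3
  rw [num_and P (fun _ : Bool => True)] at h3
  have h4 : num (fun _ : Bool => True) = 2 := by simp [num]
  rw [h4] at h3
  omega

end Assembly

/-- Every large 3-graph with minimum vertex degree at least `(5/9 + γ) C(n,2)` has a
`K₃³(m)`-factor. -/
theorem K33m_factor (m : ℕ) (hm : 1 ≤ m) (γ : ℝ) (hγ : 0 < γ) :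
    ∃ n₀ : ℕ, ∀ n : ℕ, n₀ ≤ n → 3 * m ∣ n →
      ∀ E : Finset (Finset (Fin n)), (∀ e ∈ E, e.card = 3) →
      (∀ v : Fin n, (5 / 9 + γ) * (n.choose 2 : ℝ) ≤ (degOn E 3 {v} : ℝ)) →
      HasFactorOn E (multipartiteEdges 3 m) (Finset.univ : Finset (Fin n)) := by
  have : NeZero m := ⟨by omega⟩
  set δ := min (γ / 2) 1 with hδ
  have hδ0 : 0 < δ := lt_min (by positivity) one_pos
  obtain ⟨n₁, h⟩ := exists_tiled_univ m hδ0 (min_le_right _ _)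
  refine ⟨max n₁ ⌈2 * (5 / 9 + γ) / γ⌉₊, fun n hn hdvd E _ hE => ?_⟩
  have hn1 : 2 * (5 / 9 + γ) ≤ γ * n := by
    have h1 := (Nat.le_ceil (2 * (5 / 9 + γ) / γ)).trans
      (Nat.cast_le.mpr ((le_max_right n₁ _).trans hn))
    rw [div_le_iff₀ hγ] at h1
    linarith
  refine (h (Fin n) (by simpa using (le_max_left _ _).trans hn) (by simpa using hdvd) _
    fun v => ?_).hasFactorOn
  have h1 := two_mul_degOn_le E v
  rw [← Nat.cast_le (α := ℝ)] at h1
  push_cast at h1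
  refine le_trans ?_ h1
  have h2 := hE v
  rw [Nat.cast_choose_two] at h2
  have h3 : δ ≤ γ / 2 := min_le_left _ _
  have hn0 : (0 : ℝ) ≤ n := Nat.cast_nonneg n
  rw [Fintype.card_fin]
  have h4 : δ * (n : ℝ) ^ 2 ≤ γ / 2 * (n : ℝ) ^ 2 := by gcongr
  have h5 := mul_le_mul_of_nonneg_right hn1 hn0
  nlinarith
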